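/- arXiv:2405.03203 — 2 statements merged into one kernel-verified Lean document; each statement's English description precedes it below -/
import Mathlib

section
/- Let N=2 and let (α_λ,ψ_λ) be a solution of (P)_λ with α_λ < 0. Then ∫_{Ω_+} |∇ψ_λ|² ≤ (p+1)/(8π), where Ω_+ = {x∈Ω : α_λ + λψ_λ(x) > 0} is the plasma region, and equality holds if and only if Ω_+ is a disk and ψ_λ is radial in Ω_+. -/
open MeasureTheory Metric Filter Real Set
noncomputable section

/-- The Laplacian of `f : ℝᴺ → ℝ` as the sum of second partial derivatives. -/
def lap {N : ℕ} (f : EuclideanSpace ℝ (Fin N) → ℝ) (x : EuclideanSpace ℝ (Fin N)) : ℝ :=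
  ∑ i : Fin N, fderiv ℝ (fun y => fderiv ℝ f y (EuclideanSpace.single i 1)) x
    (EuclideanSpace.single i 1)

/-- `(α, ψ)` is a solution of the problem `(P)_λ` on `Ω`. -/
structure IsSol {N : ℕ} (Ω : Set (EuclideanSpace ℝ (Fin N))) (p lam α : ℝ)
    (ψ : EuclideanSpace ℝ (Fin N) → ℝ) : Prop where
  contOn : ContinuousOn ψ (closure Ω)
  smooth : ContDiffOn ℝ 2 ψ Ω
  pde : ∀ x ∈ Ω, -lap ψ x = max (α + lam * ψ x) 0 ^ p
  bdry : ∀ x ∈ frontier Ω, ψ x = 0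
  constr : ∫ x in Ω, max (α + lam * ψ x) 0 ^ p = 1

/-- The Euclidean plane. -/
abbrev Plane := EuclideanSpace ℝ (Fin 2)

section Kernel

open Topology
open scoped RealInnerProductSpace

/-- The gravitational kernel `x / |x|²` of the plane, tested against the vector `e`. -/
def kern (e x : Plane) : ℝ := ⟪e, x⟫ / ‖x‖ ^ 2

lemma ae_nonneg_max_zero {X : Type*} [MeasurableSpace X] {μ : Measure X} (g : X → ℝ) :
    0 ≤ᵐ[μ] fun x => max (g x) 0 :=
  ae_of_all _ fun _ => le_max_right _ _

lemma measurable_kern (e : Plane) : Measurable (kern e) := by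
  unfold kern; fun_prop

lemma abs_kern_le (e x : Plane) : |kern e x| ≤ ‖e‖ * ‖x‖⁻¹ := by
  unfold kern
  rcases eq_or_ne x 0 with rfl | hx
  · simp
  have hx' : 0 < ‖x‖ := norm_pos_iff.2 hx
  rw [abs_div, abs_of_pos (pow_pos hx' 2), div_le_iff₀ (by positivity)]
  calc |⟪e, x⟫| ≤ ‖e‖ * ‖x‖ := abs_real_inner_le_norm e x
    _ = ‖e‖ * ‖x‖⁻¹ * ‖x‖ ^ 2 := by field_simp

lemma kern_smul (a : ℝ) (e x : Plane) : kern (a • e) x = a * kern e x := by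
  unfold kern; rw [real_inner_smul_left]; ring

lemma superlevel_kern {e : Plane} (he : ‖e‖ = 1) {c : ℝ} (hc : 0 < c) :
    {x | c < kern e x} = ball ((1 / (2 * c)) • e) (1 / (2 * c)) := by
  ext x
  have hr : 0 < 1 / (2 * c) := by positivity
  rw [mem_ofPred_eq, mem_ball, dist_eq_norm, ← sq_lt_sq₀ (norm_nonneg _) hr.le,
    norm_sub_sq_real, real_inner_smul_right, norm_smul, he, real_inner_comm, Real.norm_of_nonneg hr.le]
  unfold kern
  rcases eq_or_ne x 0 with rfl | hx
  · simp [hc.le]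
  have hx' : 0 < ‖x‖ ^ 2 := by have := norm_pos_iff.2 hx; positivity
  rw [lt_div_iff₀ hx']
  have : ‖x‖ ^ 2 - 2 * (1 / (2 * c) * ⟪e, x⟫) + (1 / (2 * c) * 1) ^ 2 - (1 / (2 * c)) ^ 2
      = (c * ‖x‖ ^ 2 - ⟪e, x⟫) / c := by field_simp; ring
  rw [← sub_neg, ← sub_neg (a := _ - _ + _), this, div_lt_iff₀ hc, zero_mul]

lemma volume_ball_plane (x : Plane) {r : ℝ} (hr : 0 ≤ r) :
    volume (ball x r) = ENNReal.ofReal (π * r ^ 2) := by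
  rw [EuclideanSpace.volume_ball_fin_two, mul_comm, ENNReal.ofReal_mul pi_pos.le,
    ENNReal.ofReal_pow hr]

lemma lintegral_Ioi_inv_sq {a c : ℝ} (ha : 0 ≤ a) (hc : 0 < c) :
    ∫⁻ t in Ioi (0 : ℝ), ENNReal.ofReal (a / (c + t) ^ 2) = ENNReal.ofReal (a / c) := by
  have hd : ∀ x ∈ Ioi (0 : ℝ), HasDerivAt (fun t => -(a / (c + t))) (a / (c + x) ^ 2) x := by
    intro x hx
    have hx0 : c + x ≠ 0 := by have := mem_Ioi.1 hx; positivity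
    have h := ((hasDerivAt_const x a).div ((hasDerivAt_id x).const_add c) hx0).neg
    refine HasDerivAt.congr_deriv h ?_
    simp only [id]
    ring
  have hcont : ContinuousWithinAt (fun t => -(a / (c + t))) (Ici 0) 0 := by
    apply ContinuousAt.continuousWithinAt
    have : c + 0 ≠ 0 := by simpa using hc.ne'
    fun_prop (disch := assumption)
  have hpos : ∀ x ∈ Ioi (0 : ℝ), 0 ≤ a / (c + x) ^ 2 := fun x _ => by positivity
  have hlim : Tendsto (fun t => -(a / (c + t))) atTop (𝓝 0) := by
    have : Tendsto (fun t : ℝ => c + t) atTop atTop := tendsto_atTop_add_const_left _ _ tendsto_id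
    simpa using (this.const_div_atTop a).neg
  rw [← ofReal_integral_eq_lintegral_ofReal
    (integrableOn_Ioi_deriv_of_nonneg hcont hd hpos hlim)
    ((ae_restrict_mem measurableSet_Ioi).mono hpos),
    integral_Ioi_of_hasDerivAt_of_nonneg hcont hd hpos hlim]
  simp

lemma lintegral_posPart_kern {e : Plane} (he : ‖e‖ = 1) {c : ℝ} (hc : 0 < c) :
    ∫⁻ x, ENNReal.ofReal (max (kern e x - c) 0) = ENNReal.ofReal (π / (4 * c)) := by
  rw [lintegral_eq_lintegral_meas_lt _ (ae_nonneg_max_zero _)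
    (((measurable_kern e).sub_const c).max measurable_const).aemeasurable,
    show π / (4 * c) = (π / 4) / c by field_simp,
    ← lintegral_Ioi_inv_sq (by positivity) hc]
  refine setLIntegral_congr_fun measurableSet_Ioi fun t ht => ?_
  have ht : 0 < t := ht
  have : {x | t < max (kern e x - c) 0} = {x | c + t < kern e x} := by
    ext x; simp only [mem_ofPred_eq, lt_max_iff]
    constructor
    · rintro (h | h) <;> linarith
    · intro h; left; linarith
  simp only [this]
  rw [superlevel_kern he (by positivity), volume_ball_plane _ (by positivity)]
  congr 1; field_simp; ring

lemma lintegral_posPart_inv_norm :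
    ∫⁻ x : Plane, ENNReal.ofReal (max (‖x‖⁻¹ - 1) 0) = ENNReal.ofReal π := by
  rw [lintegral_eq_lintegral_meas_lt _ (ae_nonneg_max_zero _) (by fun_prop),
    show π = π / 1 by simp, ← lintegral_Ioi_inv_sq (by positivity) one_pos]
  refine setLIntegral_congr_fun measurableSet_Ioi fun t ht => ?_
  have ht : 0 < t := ht
  have : {x : Plane | t < max (‖x‖⁻¹ - 1) 0} =ᵐ[volume] ball 0 (1 + t)⁻¹ := by
    have h0 : ∀ᵐ x : Plane, x ≠ 0 := by simp [ae_iff]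
    filter_upwards [h0] with x hx
    have hx' : 0 < ‖x‖ := norm_pos_iff.2 hx
    apply propext
    change t < max (‖x‖⁻¹ - 1) 0 ↔ x ∈ ball 0 (1 + t)⁻¹
    rw [mem_ball_zero_iff, lt_max_iff, lt_inv_comm₀ hx' (by positivity)]
    constructor
    · rintro (h | h) <;> linarith
    · intro h; left; linarith
  simp only [measure_congr this]
  rw [volume_ball_plane _ (by positivity)]
  congr 1; field_simp

lemma integrable_posPart_kern {e : Plane} (he : ‖e‖ = 1) {c : ℝ} (hc : 0 < c) :
    Integrable (fun x => max (kern e x - c) 0) := by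
  refine ⟨(((measurable_kern e).sub_const c).max measurable_const).aestronglyMeasurable, ?_⟩
  rw [hasFiniteIntegral_iff_ofReal (ae_nonneg_max_zero _),
    lintegral_posPart_kern he hc]
  exact ENNReal.ofReal_lt_top

lemma integral_posPart_kern {e : Plane} (he : ‖e‖ = 1) {c : ℝ} (hc : 0 < c) :
    ∫ x, max (kern e x - c) 0 = π / (4 * c) := by
  rw [integral_eq_lintegral_of_nonneg_ae (ae_nonneg_max_zero _)
    (integrable_posPart_kern he hc).1, lintegral_posPart_kern he hc,
    ENNReal.toReal_ofReal (by positivity)]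

lemma integrable_posPart_inv_norm : Integrable (fun x : Plane => max (‖x‖⁻¹ - 1) 0) := by
  refine ⟨by fun_prop, ?_⟩
  rw [hasFiniteIntegral_iff_ofReal (ae_nonneg_max_zero _),
    lintegral_posPart_inv_norm]
  exact ENNReal.ofReal_lt_top

lemma integral_posPart_inv_norm : ∫ x : Plane, max (‖x‖⁻¹ - 1) 0 = π := by
  rw [integral_eq_lintegral_of_nonneg_ae (ae_nonneg_max_zero _)
    integrable_posPart_inv_norm.1, lintegral_posPart_inv_norm,
    ENNReal.toReal_ofReal (by positivity)]

lemma integrableOn_inv_norm_sub {A : Set Plane} (hA : volume A ≠ ⊤) (y : Plane) :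
    IntegrableOn (fun x => ‖x - y‖⁻¹) A := by
  have h1 : IntegrableOn (fun x : Plane => 1 + max (‖x - y‖⁻¹ - 1) 0) A :=
    (integrableOn_const hA).add (integrable_posPart_inv_norm.comp_sub_right y).integrableOn
  refine h1.mono' (by fun_prop) (ae_of_all _ fun x => ?_)
  rw [Real.norm_of_nonneg (by positivity)]
  linarith [le_max_left (‖x - y‖⁻¹ - 1) 0]

lemma setIntegral_inv_norm_sub_le {A : Set Plane} (hA : volume A ≠ ⊤) (y : Plane) :
    ∫ x in A, ‖x - y‖⁻¹ ≤ volume.real A + π := by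
  have h1 := (integrable_posPart_inv_norm.comp_sub_right y)
  calc ∫ x in A, ‖x - y‖⁻¹ ≤ ∫ x in A, (1 + max (‖x - y‖⁻¹ - 1) 0) := by
        refine setIntegral_mono (integrableOn_inv_norm_sub hA y)
          ((integrableOn_const hA).add h1.integrableOn) fun x => ?_
        linarith [le_max_left (‖x - y‖⁻¹ - 1) 0]
    _ = volume.real A + ∫ x in A, max (‖x - y‖⁻¹ - 1) 0 := by
        have h := integral_add (μ := volume.restrict A) (integrableOn_const (C := (1 : ℝ)) hA)
          h1.integrableOn
        rw [h]; simp
    _ ≤ volume.real A + ∫ x, max (‖x - y‖⁻¹ - 1) 0 := by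
        gcongr
        · exact ae_of_all _ fun x => le_max_right _ _
        · exact Measure.restrict_le_self
    _ = _ := by
        rw [integral_sub_right_eq_self (fun x : Plane => max (‖x‖⁻¹ - 1) 0) y,
          integral_posPart_inv_norm]

lemma integrableOn_kern_sub {A : Set Plane} (hA : volume A ≠ ⊤) (e y : Plane) :
    IntegrableOn (fun x => kern e (x - y)) A := by
  refine ((integrableOn_inv_norm_sub hA y).const_mul ‖e‖).mono'
    ((measurable_kern e).comp (measurable_id.sub_const y)).aestronglyMeasurable
    (ae_of_all _ fun x => abs_kern_le e _)

lemma integral_posPart_kern_sub {e : Plane} (he : ‖e‖ = 1) {c : ℝ} (hc : 0 < c) (y : Plane) :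
    ∫ x, max (kern e (x - y) - c) 0 = π / (4 * c) := by
  rw [integral_sub_right_eq_self (fun x : Plane => max (kern e x - c) 0) y,
    integral_posPart_kern he hc]

/-- Among the sets of given area, the disk tangent at `y` exerts the largest attraction at `y`. -/
lemma setIntegral_kern_sub_le {A : Set Plane} (hA : MeasurableSet A) {r : ℝ} (hr : 0 < r)
    (hvol : volume A = ENNReal.ofReal (π * r ^ 2)) {e : Plane} (he : ‖e‖ = 1) (y : Plane) :
    ∫ x in A, kern e (x - y) ≤ π * r ∧
      (∫ x in A, kern e (x - y) = π * r → A =ᵐ[volume] ball (y + r • e) r) := by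
  have hAtop : volume A ≠ ⊤ := hvol ▸ ENNReal.ofReal_ne_top
  set c : ℝ := 1 / (2 * r) with hcdef
  have hc : 0 < c := by positivity
  have hk := integrableOn_kern_sub hAtop e y
  have hP : Integrable (fun x => max (kern e (x - y) - c) 0) :=
    (integrable_posPart_kern he hc).comp_sub_right y
  have hkc : Integrable (A.indicator fun x => kern e (x - y) - c) :=
    (integrable_indicator_iff hA).2 (hk.sub (integrableOn_const hAtop))
  have hle : (A.indicator fun x => kern e (x - y) - c) ≤ fun x => max (kern e (x - y) - c) 0 :=
    fun x => indicator_le' (fun x _ => le_max_left _ _) (fun x _ => le_max_right _ _) x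
  have hsplit : ∫ x in A, kern e (x - y)
      = (∫ x, A.indicator (fun x => kern e (x - y) - c) x) + c * (π * r ^ 2) := by
    rw [integral_indicator hA, integral_sub hk (integrableOn_const hAtop)]
    simp only [integral_const, smul_eq_mul, measureReal_def, Measure.restrict_apply_univ, hvol]
    rw [ENNReal.toReal_ofReal (by positivity)]; ring
  have htot : π * r = (∫ x, max (kern e (x - y) - c) 0) + c * (π * r ^ 2) := by
    rw [integral_posPart_kern_sub he hc, hcdef]; field_simp
    norm_num
  refine ⟨?_, fun heq => ?_⟩
  · rw [hsplit, htot]; gcongr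
  · have hae := (integral_eq_iff_of_ae_le hkc hP (ae_of_all _ hle)).1 (by linarith)
    have hball : ball (y + r • e) r = {x | c < kern e (x - y)} := by
      have h := superlevel_kern he hc
      have hr' : 1 / (2 * c) = r := by rw [hcdef]; field_simp
      rw [hr'] at h
      ext x
      have hx := congrArg (fun S => x - y ∈ S) h
      simp only [mem_ofPred_eq, mem_ball, dist_eq_norm, eq_iff_iff] at hx ⊢
      rw [hx, sub_add_eq_sub_sub]
    symm
    refine ae_eq_of_ae_subset_of_measure_ge ?_ ?_ measurableSet_ball.nullMeasurableSet hAtop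
    · filter_upwards [hae] with x hx hxb
      by_contra hxA
      have hxb' : x ∈ ball (y + r • e) r := hxb
      rw [hball] at hxb'
      have hxA' : x ∉ A := hxA
      rw [indicator_of_notMem hxA'] at hx
      have := le_max_left (kern e (x - y) - c) 0
      simp only [mem_ofPred_eq] at hxb'
      linarith
    · rw [hvol, volume_ball_plane _ hr.le]

end Kernel

section Representation

open Topology
open scoped RealInnerProductSpace

/-- The unit vector of the plane with polar angle `θ`. -/
def unitVec (θ : ℝ) : Plane := !₂[Real.cos θ, Real.sin θ]

lemma norm_unitVec (θ : ℝ) : ‖unitVec θ‖ = 1 := by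
  simp [unitVec, EuclideanSpace.norm_eq]

lemma continuous_unitVec : Continuous unitVec := by
  unfold unitVec
  refine (PiLp.continuous_toLp 2 _).comp (continuous_pi fun i => ?_)
  fin_cases i
  · exact Real.continuous_cos
  · exact Real.continuous_sin

lemma integral_plane_eq_polar (h : Plane → ℝ) :
    ∫ z, h z = ∫ p in Ioi (0 : ℝ) ×ˢ Ioo (-π) π, p.1 * h (p.1 • unitVec p.2) := by
  let φ : ℝ × ℝ ≃ᵐ Plane :=
    MeasurableEquiv.finTwoArrow.symm.trans (MeasurableEquiv.toLp 2 (Fin 2 → ℝ))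
  have hφ : MeasurePreserving φ :=
    (PiLp.volume_preserving_toLp (Fin 2)).comp (volume_preserving_finTwoArrow ℝ).symm
  rw [← hφ.integral_comp' h, ← integral_comp_polarCoord_symm]
  refine setIntegral_congr_fun (measurableSet_Ioi.prod measurableSet_Ioo) fun p _ => ?_
  have : φ (polarCoord.symm p) = p.1 • unitVec p.2 := by
    ext i
    fin_cases i
    · change p.1 * Real.cos p.2 = _
      simp [unitVec]
    · change p.1 * Real.sin p.2 = _
      simp [unitVec]
  simp only [smul_eq_mul, this]

lemma integral_kern_gradient {W : Plane → ℝ} {W' : Plane → Plane}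
    (hW : ∀ y, HasGradientAt W (W' y) y) (hW' : Continuous W') (hsupp : HasCompactSupport W)
    (hsupp' : HasCompactSupport W') (x : Plane) :
    ∫ y, kern (W' y) (x - y) = 2 * π * W x := by
  have hz : ∫ y, kern (W' y) (x - y) = ∫ z, kern (W' (x - z)) z := by
    rw [← integral_sub_left_eq_self _ _ x]; simp
  obtain ⟨R, hR⟩ : ∃ R : ℝ, ∀ z : Plane, R < ‖z‖ → W (x - z) = 0 ∧ W' (x - z) = 0 := by
    obtain ⟨R₁, h₁⟩ := hsupp.isCompact.isBounded.subset_closedBall x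
    obtain ⟨R₂, h₂⟩ := hsupp'.isCompact.isBounded.subset_closedBall x
    refine ⟨max R₁ R₂, fun z hz => ⟨?_, ?_⟩⟩
    · by_contra h
      have := h₁ (subset_tsupport _ h)
      simp at this
      linarith [le_max_left R₁ R₂]
    · by_contra h
      have := h₂ (subset_tsupport _ h)
      simp at this
      linarith [le_max_right R₁ R₂]
  set g : ℝ × ℝ → ℝ := fun p => ⟪W' (x - p.1 • unitVec p.2), unitVec p.2⟫ with hg
  have hgc : Continuous g := by
    have := continuous_unitVec
    fun_prop
  have hg0 : ∀ r θ, R < r → 0 ≤ r → g (r, θ) = 0 := by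
    intro r θ hr hr0
    have := (hR (r • unitVec θ) (by rwa [norm_smul, norm_unitVec, mul_one,
      Real.norm_of_nonneg hr0])).2
    simp [hg, this]
  have hgi : IntegrableOn g (Ioi (0 : ℝ) ×ˢ Ioo (-π) π) := by
    have h1 : IntegrableOn g (Icc (0 : ℝ) R ×ˢ Icc (-π) π) :=
      hgc.continuousOn.integrableOn_compact (isCompact_Icc.prod isCompact_Icc)
    refine h1.of_forall_sdiff_eq_zero (measurableSet_Ioi.prod measurableSet_Ioo) ?_
    rintro ⟨r, θ⟩ ⟨⟨hr, hθ⟩, hn⟩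
    have hr : 0 < r := hr
    refine hg0 r θ ?_ hr.le
    by_contra hrR
    exact hn ⟨⟨hr.le, not_lt.1 hrR⟩, Ioo_subset_Icc_self hθ⟩
  rw [hz, integral_plane_eq_polar]
  have hpq : ∀ p ∈ Ioi (0 : ℝ) ×ˢ Ioo (-π) π,
      p.1 * kern (W' (x - p.1 • unitVec p.2)) (p.1 • unitVec p.2) = g p := by
    rintro ⟨r, θ⟩ ⟨hr, -⟩
    have hr : 0 < r := hr
    simp only [kern, hg, norm_smul, norm_unitVec, real_inner_smul_right]
    rw [Real.norm_of_nonneg hr.le]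
    field_simp
  rw [setIntegral_congr_fun (measurableSet_Ioi.prod measurableSet_Ioo) hpq,
    Measure.volume_eq_prod, ← setIntegral_prod_swap, setIntegral_prod]
  · have hin : ∀ θ, ∫ r in Ioi (0 : ℝ), g (r, θ) = W x := by
      intro θ
      have hd : ∀ r ∈ Ici (0 : ℝ),
          HasDerivAt (fun r => -W (x - r • unitVec θ)) (g (r, θ)) r := by
        intro r _
        have h1 : HasDerivAt (fun r : ℝ => x - r • unitVec θ) (-unitVec θ) r := by
          simpa using ((hasDerivAt_id r).smul_const (unitVec θ)).const_sub x
        have h2 := ((hW (x - r • unitVec θ)).hasFDerivAt.comp_hasDerivAt r h1).neg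
        refine HasDerivAt.congr_deriv h2 ?_
        simp [hg]
      have hlim : Tendsto (fun r : ℝ => -W (x - r • unitVec θ)) atTop (𝓝 0) := by
        refine tendsto_const_nhds.congr' ?_
        filter_upwards [eventually_gt_atTop R, eventually_ge_atTop (0 : ℝ)] with r hr hr0
        rw [(hR (r • unitVec θ) (by rwa [norm_smul, norm_unitVec, mul_one,
          Real.norm_of_nonneg hr0])).1, neg_zero]
      have hi : IntegrableOn (fun r => g (r, θ)) (Ioi 0) := by
        have h1 : IntegrableOn (fun r => g (r, θ)) (Icc (0 : ℝ) R) :=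
          (hgc.comp (by fun_prop : Continuous fun r : ℝ => (r, θ))).continuousOn.integrableOn_Icc
        refine h1.of_forall_sdiff_eq_zero measurableSet_Ioi ?_
        rintro r ⟨hr, hn⟩
        have hr : 0 < r := hr
        refine hg0 r θ ?_ hr.le
        by_contra hrR
        exact hn ⟨hr.le, not_lt.1 hrR⟩
      rw [integral_Ioi_of_hasDerivAt_of_tendsto' hd hi hlim]
      simp
    simp only [Prod.swap_prod_mk, hin, integral_const]
    simp [measureReal_def, pi_pos.le]
    left; ring
  · exact hgi.swap

end Representation

/-- A nonnegative compactly supported function on the plane solving `-Δv = f(v)` where it is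
positive, for a positive nondecreasing nonlinearity `f`. -/
structure IsProfile (f : ℝ → ℝ) (v : Plane → ℝ) : Prop where
  cont : Continuous v
  supp : HasCompactSupport v
  nonneg : ∀ x, 0 ≤ v x
  smooth : ContDiffOn ℝ 2 v {x | 0 < v x}
  grad_bdd : ∃ C, ∀ x, 0 < v x → ‖gradient v x‖ ≤ C
  f_cont : Continuous f
  f_mono : Monotone f
  f_pos : ∀ t, 0 < t → 0 < f t
  f_zero : f 0 = 0
  pde : ∀ x, 0 < v x → -lap v x = f (v x)

/-- The superlevel set `{t < v}`. -/
def lev (v : Plane → ℝ) (t : ℝ) : Set Plane := {x | t < v x}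

/-- The area of the superlevel set `{t < v}`. -/
def area (v : Plane → ℝ) (t : ℝ) : ℝ := volume.real (lev v t)

/-- The mass of `f(v)` in the superlevel set `{t < v}`. -/
def mass (f : ℝ → ℝ) (v : Plane → ℝ) (t : ℝ) : ℝ := ∫ x in lev v t, f (v x)

namespace IsProfile

open Topology
open scoped RealInnerProductSpace

variable {f : ℝ → ℝ} {v : Plane → ℝ}

lemma isOpen_lev (h : IsProfile f v) (t : ℝ) : IsOpen (lev v t) :=
  isOpen_lt continuous_const h.cont

lemma measurableSet_lev (h : IsProfile f v) (t : ℝ) : MeasurableSet (lev v t) :=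
  (h.isOpen_lev t).measurableSet

lemma lev_anti (v : Plane → ℝ) : Antitone (lev v) := fun _ _ hst _ hx => lt_of_le_of_lt hst hx

lemma lev_subset_tsupport {t : ℝ} (ht : 0 ≤ t) : lev v t ⊆ tsupport v := fun _ hx =>
  subset_tsupport _ (ne_of_gt (lt_of_le_of_lt ht hx))

lemma volume_lev_ne_top (h : IsProfile f v) {t : ℝ} (ht : 0 ≤ t) : volume (lev v t) ≠ ⊤ :=
  ((measure_mono (lev_subset_tsupport ht)).trans_lt h.supp.isCompact.measure_lt_top).ne

lemma f_nonneg (h : IsProfile f v) (x : Plane) : 0 ≤ f (v x) := by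
  rw [← h.f_zero]; exact h.f_mono (h.nonneg x)

lemma integrable_f (h : IsProfile f v) : Integrable fun x => f (v x) :=
  (h.f_cont.comp h.cont).integrable_of_hasCompactSupport
    (h.supp.comp_left h.f_zero)

lemma exists_bound (h : IsProfile f v) : ∃ M, 0 < M ∧ ∀ x, v x ≤ M := by
  obtain ⟨C, hC⟩ := h.cont.bounded_above_of_compact_support h.supp
  exact ⟨max C 1, by positivity, fun x => (le_abs_self _).trans ((hC x).trans (le_max_left _ _))⟩

lemma mass_anti (h : IsProfile f v) : Antitone (mass f v) := fun _ _ hst =>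
  setIntegral_mono_set h.integrable_f.integrableOn (ae_of_all _ fun x => h.f_nonneg x)
    (lev_anti v hst).eventuallyLE

lemma mass_nonneg (h : IsProfile f v) (t : ℝ) : 0 ≤ mass f v t :=
  integral_nonneg fun x => h.f_nonneg x

lemma area_anti (h : IsProfile f v) : AntitoneOn (area v) (Ici 0) := fun _ hs _ _ hst =>
  measureReal_mono (lev_anti v hst) (h.volume_lev_ne_top hs)

lemma differentiableAt (h : IsProfile f v) {x : Plane} (hx : 0 < v x) :
    DifferentiableAt ℝ v x :=
  (h.smooth.contDiffAt ((h.isOpen_lev 0).mem_nhds hx)).differentiableAt (by norm_num)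

lemma contDiffOn_fderiv (h : IsProfile f v) : ContDiffOn ℝ 1 (fderiv ℝ v) (lev v 0) :=
  h.smooth.fderiv_of_isOpen (h.isOpen_lev 0) (by norm_num)

lemma continuousOn_gradient (h : IsProfile f v) : ContinuousOn (gradient v) (lev v 0) :=
  (InnerProductSpace.toDual ℝ Plane).symm.continuous.comp_continuousOn
    h.contDiffOn_fderiv.continuousOn

lemma gradient_apply (x : Plane) (i : Fin 2) :
    gradient v x i = fderiv ℝ v x (EuclideanSpace.single i 1) := by
  have : ⟪gradient v x, EuclideanSpace.single i (1 : ℝ)⟫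
      = fderiv ℝ v x (EuclideanSpace.single i 1) := by
    simp [gradient]
  rw [← this, EuclideanSpace.inner_single_right]; simp

lemma measurable_gradient (v : Plane → ℝ) : Measurable (gradient v) :=
  (InnerProductSpace.toDual ℝ Plane).symm.continuous.measurable.comp (measurable_fderiv ℝ v)

lemma continuous_cutoff (h : IsProfile f v) {F : Type*} [NormedAddCommGroup F] [NormedSpace ℝ F]
    {a : ℝ → ℝ} (ha : Continuous a) {δ : ℝ} (hδ : 0 < δ) (ha0 : ∀ t ≤ δ, a t = 0)
    {w : Plane → F} (hw : ContinuousOn w (lev v 0)) :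
    Continuous (fun y => a (v y) • w y) := by
  rw [continuous_iff_continuousAt]
  intro y
  by_cases hy : 0 < v y
  · exact (ha.comp h.cont).continuousAt.smul (hw.continuousAt ((h.isOpen_lev 0).mem_nhds hy))
  · have : (fun y => a (v y) • w y) =ᶠ[𝓝 y] fun _ => 0 := by
      have hlt : v y < δ := by linarith
      filter_upwards [h.cont.continuousAt.eventually_lt continuousAt_const hlt] with z hz
      rw [ha0 _ hz.le, zero_smul]
    exact continuousAt_const.congr this.symm

lemma hasCompactSupport_cutoff (h : IsProfile f v) {F : Type*} [NormedAddCommGroup F]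
    [NormedSpace ℝ F] {a : ℝ → ℝ} (ha0 : a 0 = 0) (w : Plane → F) :
    HasCompactSupport (fun y => a (v y) • w y) := by
  refine h.supp.mono fun y hy => ?_
  rw [Function.mem_support] at hy ⊢
  contrapose! hy
  rw [hy, ha0, zero_smul]

lemma primitive_eq_zero {q : ℝ → ℝ} {δ : ℝ} (hδ : 0 < δ) (hq0 : ∀ t ≤ δ, q t = 0) {t : ℝ}
    (ht : t ≤ δ) : ∫ τ in (0 : ℝ)..t, q τ = 0 := by
  refine intervalIntegral.integral_zero_ae (ae_of_all _ fun τ hτ => hq0 τ ?_)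
  exact hτ.2.trans (max_le hδ.le ht)

lemma hasFDerivAt_primitive (h : IsProfile f v) {q : ℝ → ℝ} (hq : Continuous q) {δ : ℝ}
    (hδ : 0 < δ) (hq0 : ∀ t ≤ δ, q t = 0) (y : Plane) :
    HasFDerivAt (fun y => ∫ τ in (0 : ℝ)..v y, q τ) (q (v y) • fderiv ℝ v y) y := by
  by_cases hy : 0 < v y
  · exact (hq.integral_hasStrictDerivAt 0 (v y)).hasDerivAt.comp_hasFDerivAt y
      (h.differentiableAt hy).hasFDerivAt
  · have hlt : v y < δ := by linarith
    rw [hq0 _ hlt.le, zero_smul]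
    refine (hasFDerivAt_const (0 : ℝ) y).congr_of_eventuallyEq ?_
    filter_upwards [h.cont.continuousAt.eventually_lt continuousAt_const hlt] with z hz
    exact primitive_eq_zero hδ hq0 hz.le

lemma continuous_primitive {q : ℝ → ℝ} (hq : Continuous q) :
    Continuous fun t => ∫ τ in (0 : ℝ)..t, q τ :=
  intervalIntegral.continuous_primitive (fun a b => hq.intervalIntegrable a b) 0

/-- Testing the equation with the field `Q(v) ∇v`, where `Q' = q`. -/
lemma integral_cutoff_gradient_sq (h : IsProfile f v) {q : ℝ → ℝ} (hq : Continuous q) {δ : ℝ}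
    (hδ : 0 < δ) (hq0 : ∀ t ≤ δ, q t = 0) :
    ∫ x, q (v x) * ‖gradient v x‖ ^ 2 = ∫ x, f (v x) * ∫ τ in (0 : ℝ)..v x, q τ := by
  set Q : ℝ → ℝ := fun t => ∫ τ in (0 : ℝ)..t, q τ with hQ
  have hQc : Continuous Q := continuous_primitive hq
  have hQ0 : ∀ t ≤ δ, Q t = 0 := fun t ht => primitive_eq_zero hδ hq0 ht
  have hfd : ∀ y, HasFDerivAt (fun y => Q (v y)) (q (v y) • fderiv ℝ v y) y :=
    h.hasFDerivAt_primitive hq hδ hq0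
  let e : Fin 2 → Plane := fun i => EuclideanSpace.single i 1
  have hd : ∀ i, ContDiffOn ℝ 1 (fun y => fderiv ℝ v y (e i)) (lev v 0) := fun i =>
    h.contDiffOn_fderiv.clm_apply contDiffOn_const
  have hdd : ∀ i, ContinuousOn
      (fun x => fderiv ℝ (fun y => fderiv ℝ v y (e i)) x (e i)) (lev v 0) := fun i =>
    ((hd i).continuousOn_fderiv_of_isOpen (h.isOpen_lev 0) le_rfl).clm_apply continuousOn_const
  have hcut : ∀ (a : ℝ → ℝ), Continuous a → (∀ t ≤ δ, a t = 0) → ∀ w : Plane → ℝ,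
      ContinuousOn w (lev v 0) → Integrable fun y => a (v y) * w y := fun a ha ha0 w hw =>
    (h.continuous_cutoff ha hδ ha0 hw).integrable_of_hasCompactSupport
      (h.hasCompactSupport_cutoff (ha0 0 hδ.le) w)
  have hi1 : ∀ i, Integrable fun x => q (v x) * (fderiv ℝ v x (e i) * fderiv ℝ v x (e i)) :=
    fun i => hcut q hq hq0 _ ((hd i).continuousOn.mul (hd i).continuousOn)
  have hi2 : ∀ i, Integrable fun x =>
      Q (v x) * fderiv ℝ (fun y => fderiv ℝ v y (e i)) x (e i) :=
    fun i => hcut Q hQc hQ0 _ (hdd i)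
  have key : ∀ i, ∫ x, Q (v x) * fderiv ℝ (fun y => fderiv ℝ v y (e i)) x (e i)
      = -∫ x, q (v x) * (fderiv ℝ v x (e i) * fderiv ℝ v x (e i)) := by
    intro i
    have hs : ∀ x, (fderiv ℝ (fun y => Q (v y)) x) (e i) * fderiv ℝ v x (e i)
        = q (v x) * (fderiv ℝ v x (e i) * fderiv ℝ v x (e i)) := fun x => by
      rw [(hfd x).fderiv]; simp [mul_assoc]
    rw [integral_mul_fderiv_eq_neg_fderiv_mul_of_integrable]
    · simp only [hs]
    · simp only [hs]; exact hi1 i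
    · exact hi2 i
    · exact hcut Q hQc hQ0 _ (hd i).continuousOn
    · exact fun x _ => (hfd x).differentiableAt
    · intro x hx
      have hsub : tsupport (fun y => Q (v y)) ⊆ {y | δ ≤ v y} := by
        refine closure_minimal (fun y hy => ?_) (isClosed_le continuous_const h.cont)
        by_contra hlt
        exact hy (hQ0 _ (not_le.1 hlt).le)
      exact ((hd i).contDiffAt ((h.isOpen_lev 0).mem_nhds
        (hδ.trans_le (hsub hx)))).differentiableAt (by norm_num)
  have hnorm : ∀ x, q (v x) * ‖gradient v x‖ ^ 2
      = ∑ i, q (v x) * (fderiv ℝ v x (e i) * fderiv ℝ v x (e i)) := fun x => by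
    rw [EuclideanSpace.norm_sq_eq, Finset.mul_sum]
    refine Finset.sum_congr rfl fun i _ => ?_
    rw [gradient_apply, Real.norm_eq_abs, sq_abs, sq]
  have hlap : ∀ x, f (v x) * Q (v x)
      = -∑ i, Q (v x) * fderiv ℝ (fun y => fderiv ℝ v y (e i)) x (e i) := fun x => by
    by_cases hx : 0 < v x
    · rw [← h.pde x hx, lap, ← Finset.mul_sum]; ring
    · have : v x ≤ δ := by linarith
      simp [hQ0 _ this]
  change _ = ∫ x, f (v x) * Q (v x)
  simp only [hnorm, hlap]
  rw [integral_neg, integral_finsetSum _ fun i _ => hi1 i, integral_finsetSum _ fun i _ => hi2 i]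
  simp [key]

/-- Fubini's theorem over the subgraph of `v`. -/
lemma integral_mul_setIntegral_lev (h : IsProfile f v) {q : ℝ → ℝ} (hq : Continuous q)
    {w : Plane → ℝ} (hw : IntegrableOn w (lev v 0)) :
    ∫ t in Ioi (0 : ℝ), q t * ∫ x in lev v t, w x
      = ∫ x in lev v 0, w x * ∫ τ in (0 : ℝ)..v x, q τ := by
  obtain ⟨M, hM, hvM⟩ := h.exists_bound
  set q₀ : ℝ → ℝ := (Ioc 0 M).indicator q with hq₀
  set w₀ : Plane → ℝ := (lev v 0).indicator w with hw₀
  have hq₀i : Integrable q₀ := (integrable_indicator_iff measurableSet_Ioc).2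
    (hq.continuousOn.integrableOn_Icc.mono_set Ioc_subset_Icc_self)
  have hw₀i : Integrable w₀ := (integrable_indicator_iff (h.measurableSet_lev 0)).2 hw
  set S : Set (ℝ × Plane) := {p | p.1 < v p.2} with hS
  have hSm : MeasurableSet S := measurableSet_lt measurable_fst (h.cont.measurable.comp measurable_snd)
  have hpq : Integrable (S.indicator fun p : ℝ × Plane => q₀ p.1 * w₀ p.2)
      (volume.prod volume) := (hq₀i.mul_prod hw₀i).indicator hSm
  have hswap := integral_integral_swap (f := fun t x => S.indicator (fun p => q₀ p.1 * w₀ p.2) (t, x))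
    hpq
  have h1 : ∀ t, ∫ x, S.indicator (fun p : ℝ × Plane => q₀ p.1 * w₀ p.2) (t, x)
      = (Ioi (0 : ℝ)).indicator (fun t => q t * ∫ x in lev v t, w x) t := by
    intro t
    by_cases ht : 0 < t
    · rw [indicator_of_mem (mem_Ioi.2 ht)]
      by_cases htM : t ≤ M
      · rw [← integral_const_mul, ← integral_indicator (h.measurableSet_lev t)]
        congr 1; ext x
        by_cases hx : t < v x
        · rw [indicator_of_mem (show (t, x) ∈ S from hx), indicator_of_mem (show x ∈ lev v t from hx)]
          simp only [hq₀, hw₀]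
          rw [indicator_of_mem (show t ∈ Ioc 0 M from ⟨ht, htM⟩),
            indicator_of_mem (show x ∈ lev v 0 from ht.trans hx)]
        · rw [indicator_of_notMem (show (t, x) ∉ S from hx),
            indicator_of_notMem (show x ∉ lev v t from hx)]
      · have he : lev v t = ∅ := by
          ext x; simp only [lev, mem_ofPred_eq, mem_empty_iff_false, iff_false, not_lt]
          linarith [hvM x, not_le.1 htM]
        rw [he]
        have : q₀ t = 0 := indicator_of_notMem (fun hh => htM hh.2) _
        simp [indicator, this]
    · rw [indicator_of_notMem (by simpa using ht)]
      have : q₀ t = 0 := indicator_of_notMem (fun hh => ht hh.1) _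
      simp [indicator, this]
  have h2 : ∀ x, ∫ t, S.indicator (fun p : ℝ × Plane => q₀ p.1 * w₀ p.2) (t, x)
      = (lev v 0).indicator (fun x => w x * ∫ τ in (0 : ℝ)..v x, q τ) x := by
    intro x
    by_cases hx : 0 < v x
    · rw [indicator_of_mem (show x ∈ lev v 0 from hx), intervalIntegral.integral_of_le hx.le,
        ← integral_Ioc_eq_integral_Ioo.symm, ← integral_const_mul, ← integral_indicator measurableSet_Ioo]
      congr 1; ext t
      by_cases ht : t < v x
      · rw [indicator_of_mem (show (t, x) ∈ S from ht)]
        by_cases ht0 : 0 < t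
        · rw [indicator_of_mem (show t ∈ Ioo 0 (v x) from ⟨ht0, ht⟩)]
          simp only [hq₀, hw₀]
          rw [indicator_of_mem (show t ∈ Ioc 0 M from ⟨ht0, ht.le.trans (hvM x)⟩),
            indicator_of_mem (show x ∈ lev v 0 from hx), mul_comm]
        · rw [indicator_of_notMem (show t ∉ Ioo 0 (v x) from fun hh => ht0 hh.1)]
          simp only [hq₀]
          rw [indicator_of_notMem (show t ∉ Ioc 0 M from fun hh => ht0 hh.1), zero_mul]
      · rw [indicator_of_notMem (show (t, x) ∉ S from ht),
          indicator_of_notMem (show t ∉ Ioo 0 (v x) from fun hh => ht hh.2)]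
    · rw [indicator_of_notMem (show x ∉ lev v 0 from hx)]
      have : w₀ x = 0 := indicator_of_notMem (show x ∉ lev v 0 from hx) _
      simp [indicator, this]
  simp only [h1, h2] at hswap
  rwa [integral_indicator measurableSet_Ioi, integral_indicator (h.measurableSet_lev 0)] at hswap

end IsProfile

section Ramp

open Topology

/-- A continuous approximation from below of the indicator of `(0, ∞)`. -/
def ramp (n : ℕ) (t : ℝ) : ℝ := max 0 (min 1 ((n + 1) * t - 1))

lemma continuous_ramp (n : ℕ) : Continuous (ramp n) := by unfold ramp; fun_prop

lemma ramp_nonneg (n : ℕ) (t : ℝ) : 0 ≤ ramp n t := le_max_left _ _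

lemma ramp_le_one (n : ℕ) (t : ℝ) : ramp n t ≤ 1 := max_le zero_le_one (min_le_left _ _)

lemma abs_ramp_le_one (n : ℕ) (t : ℝ) : |ramp n t| ≤ 1 := by
  rw [abs_of_nonneg (ramp_nonneg n t)]; exact ramp_le_one n t

lemma ramp_eq_zero {n : ℕ} {t : ℝ} (ht : t ≤ 1 / (n + 1)) : ramp n t = 0 := by
  refine max_eq_left ((min_le_right _ _).trans ?_)
  have : (0 : ℝ) < n + 1 := by positivity
  rw [le_div_iff₀ this] at ht
  linarith

lemma ramp_eq_zero_of_nonpos {n : ℕ} {t : ℝ} (ht : t ≤ 0) : ramp n t = 0 :=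
  ramp_eq_zero (ht.trans (by positivity))

lemma tendsto_ramp {t : ℝ} (ht : 0 < t) : Tendsto (fun n => ramp n t) atTop (𝓝 1) := by
  refine tendsto_const_nhds.congr' ?_
  obtain ⟨N, hN⟩ := exists_nat_gt (2 / t)
  filter_upwards [eventually_ge_atTop N] with n hn
  have h1 : (N : ℝ) ≤ n := by exact_mod_cast hn
  have h2 : 2 < (n + 1) * t := by
    rw [div_lt_iff₀ ht] at hN; nlinarith
  unfold ramp
  rw [min_eq_left (by linarith), max_eq_right zero_le_one]

end Ramp

namespace IsProfile

open Topology
open scoped RealInnerProductSpace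

variable {f : ℝ → ℝ} {v : Plane → ℝ}

lemma integrableOn_gradient_sq (h : IsProfile f v) :
    IntegrableOn (fun x => ‖gradient v x‖ ^ 2) (lev v 0) := by
  obtain ⟨C, hC⟩ := h.grad_bdd
  refine IntegrableOn.of_bound (h.volume_lev_ne_top le_rfl).lt_top
    ((measurable_gradient v).norm.pow_const 2).aestronglyMeasurable (C ^ 2) ?_
  filter_upwards [ae_restrict_mem (h.measurableSet_lev 0)] with x hx
  rw [Real.norm_of_nonneg (by positivity)]
  exact pow_le_pow_left₀ (norm_nonneg _) (hC x hx) 2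

lemma integrableOn_mass (h : IsProfile f v) : IntegrableOn (mass f v) (Ioi 0) := by
  obtain ⟨M, hM, hvM⟩ := h.exists_bound
  have h1 : IntegrableOn (mass f v) (Ioc 0 M) :=
    (h.mass_anti.antitoneOn _).integrableOn_isCompact isCompact_Icc |>.mono_set
      Ioc_subset_Icc_self
  refine h1.of_forall_sdiff_eq_zero measurableSet_Ioi fun t ht => ?_
  have htM : M < t := not_le.1 fun hh => ht.2 ⟨ht.1, hh⟩
  have he : lev v t = ∅ := by
    ext x; simp only [lev, mem_ofPred_eq, mem_empty_iff_false, iff_false, not_lt]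
    linarith [hvM x]
  simp [mass, he]

lemma cutoff_coarea (h : IsProfile f v) {q : ℝ → ℝ} (hq : Continuous q) {δ : ℝ}
    (hδ : 0 < δ) (hq0 : ∀ t ≤ δ, q t = 0) :
    ∫ x in lev v 0, ‖gradient v x‖ ^ 2 * q (v x) = ∫ t in Ioi (0 : ℝ), mass f v t * q t := by
  have h1 : ∀ x ∉ lev v 0, ‖gradient v x‖ ^ 2 * q (v x) = 0 := fun x hx => by
    rw [hq0 _ ((not_lt.1 hx).trans hδ.le), mul_zero]
  have h2 : ∀ x ∉ lev v 0, f (v x) * ∫ τ in (0 : ℝ)..v x, q τ = 0 := fun x hx => by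
    rw [primitive_eq_zero hδ hq0 ((not_lt.1 hx).trans hδ.le), mul_zero]
  rw [setIntegral_eq_integral_of_forall_compl_eq_zero h1]
  simp only [mul_comm _ (q _)]
  rw [h.integral_cutoff_gradient_sq hq hδ hq0, ← setIntegral_eq_integral_of_forall_compl_eq_zero h2,
    ← h.integral_mul_setIntegral_lev hq h.integrable_f.integrableOn]
  rfl

/-- The distribution of `v` with respect to the Dirichlet energy has density `mass f v`. -/
lemma map_energy_eq (h : IsProfile f v) :
    ((volume.restrict (lev v 0)).withDensity fun x => ENNReal.ofReal (‖gradient v x‖ ^ 2)).map v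
      = (volume.restrict (Ioi 0)).withDensity fun t => ENNReal.ofReal (mass f v t) := by
  have hi1 := h.integrableOn_gradient_sq
  have hi2 := h.integrableOn_mass
  have hm1 : Measurable fun x => ENNReal.ofReal (‖gradient v x‖ ^ 2) :=
    ((measurable_gradient v).norm.pow_const 2).ennreal_ofReal
  have hm2 : Measurable fun t => ENNReal.ofReal (mass f v t) := h.mass_anti.measurable.ennreal_ofReal
  have : IsFiniteMeasure ((volume.restrict (lev v 0)).withDensity fun x =>
      ENNReal.ofReal (‖gradient v x‖ ^ 2)) := isFiniteMeasure_withDensity_ofReal hi1.2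
  have : IsFiniteMeasure ((volume.restrict (Ioi (0 : ℝ))).withDensity fun t =>
      ENNReal.ofReal (mass f v t)) := isFiniteMeasure_withDensity_ofReal hi2.2
  refine ext_of_forall_integral_eq_of_IsFiniteMeasure fun g => ?_
  rw [integral_map h.cont.measurable.aemeasurable g.continuous.aestronglyMeasurable,
    integral_withDensity_eq_integral_toReal_smul hm1 (ae_of_all _ fun _ => ENNReal.ofReal_lt_top),
    integral_withDensity_eq_integral_toReal_smul hm2 (ae_of_all _ fun _ => ENNReal.ofReal_lt_top)]
  simp only [ENNReal.toReal_ofReal (sq_nonneg _), ENNReal.toReal_ofReal (h.mass_nonneg _),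
    smul_eq_mul]
  have hb : ∀ n t, ‖g t * ramp n t‖ ≤ ‖g‖ := fun n t => by
    rw [norm_mul]
    calc ‖g t‖ * ‖ramp n t‖ ≤ ‖g‖ * 1 :=
          mul_le_mul (g.norm_coe_le_norm t) (abs_ramp_le_one n t) (norm_nonneg _) (norm_nonneg _)
      _ = ‖g‖ := mul_one _
  have hL : Tendsto (fun n : ℕ => ∫ x in lev v 0, ‖gradient v x‖ ^ 2 * (g (v x) * ramp n (v x))) atTop
      (𝓝 (∫ x in lev v 0, ‖gradient v x‖ ^ 2 * g (v x))) := by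
    refine tendsto_integral_of_dominated_convergence (fun x => ‖gradient v x‖ ^ 2 * ‖g‖)
      (fun n => ?_) (hi1.mul_const _) (fun n => ae_of_all _ fun x => ?_) ?_
    · exact (((measurable_gradient v).norm.pow_const 2).mul ((g.continuous.measurable.comp
        h.cont.measurable).mul ((continuous_ramp n).measurable.comp
        h.cont.measurable))).aestronglyMeasurable
    · rw [norm_mul, Real.norm_of_nonneg (sq_nonneg _)]
      exact mul_le_mul_of_nonneg_left (hb n _) (sq_nonneg _)
    · filter_upwards [ae_restrict_mem (h.measurableSet_lev 0)] with x hx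
      simpa using ((tendsto_ramp hx).const_mul (g (v x))).const_mul (‖gradient v x‖ ^ 2)
  have hR : Tendsto (fun n : ℕ => ∫ t in Ioi (0 : ℝ), mass f v t * (g t * ramp n t)) atTop
      (𝓝 (∫ t in Ioi (0 : ℝ), mass f v t * g t)) := by
    refine tendsto_integral_of_dominated_convergence (fun t => mass f v t * ‖g‖)
      (fun n => ?_) (hi2.mul_const _) (fun n => ae_of_all _ fun x => ?_) ?_
    · exact (h.mass_anti.measurable.mul (g.continuous.measurable.mul
        (continuous_ramp n).measurable)).aestronglyMeasurable
    · rw [norm_mul, Real.norm_of_nonneg (h.mass_nonneg _)]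
      exact mul_le_mul_of_nonneg_left (hb n _) (h.mass_nonneg _)
    · filter_upwards [ae_restrict_mem measurableSet_Ioi] with t ht
      simpa using ((tendsto_ramp ht).const_mul (g t)).const_mul (mass f v t)
  refine tendsto_nhds_unique hL (hR.congr fun n => ?_)
  exact (h.cutoff_coarea (q := fun t => g t * ramp n t) (g.continuous.mul (continuous_ramp n))
    (by positivity : (0 : ℝ) < 1 / (n + 1)) fun t ht => by rw [ramp_eq_zero ht, mul_zero]).symm

lemma coarea (h : IsProfile f v) {q : ℝ → ℝ} (hq : Measurable q) :
    ∫ x in lev v 0, ‖gradient v x‖ ^ 2 * q (v x) = ∫ t in Ioi (0 : ℝ), mass f v t * q t := by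
  have hm1 : Measurable fun x => ENNReal.ofReal (‖gradient v x‖ ^ 2) :=
    ((measurable_gradient v).norm.pow_const 2).ennreal_ofReal
  have hm2 : Measurable fun t => ENNReal.ofReal (mass f v t) := h.mass_anti.measurable.ennreal_ofReal
  have := congrArg (fun μ : Measure ℝ => ∫ t, q t ∂μ) h.map_energy_eq
  rw [integral_map h.cont.measurable.aemeasurable hq.aestronglyMeasurable,
    integral_withDensity_eq_integral_toReal_smul hm1 (ae_of_all _ fun _ => ENNReal.ofReal_lt_top),
    integral_withDensity_eq_integral_toReal_smul hm2 (ae_of_all _ fun _ => ENNReal.ofReal_lt_top)]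
    at this
  simpa only [ENNReal.toReal_ofReal (sq_nonneg _), ENNReal.toReal_ofReal (h.mass_nonneg _),
    smul_eq_mul] using this

lemma hasGradientAt_primitive (h : IsProfile f v) {q : ℝ → ℝ} (hq : Continuous q) {δ : ℝ}
    (hδ : 0 < δ) (hq0 : ∀ t ≤ δ, q t = 0) (y : Plane) :
    HasGradientAt (fun y => ∫ τ in (0 : ℝ)..v y, q τ) (q (v y) • gradient v y) y := by
  rw [hasGradientAt_iff_hasFDerivAt]
  have h1 := h.hasFDerivAt_primitive hq hδ hq0 y
  have e : InnerProductSpace.toDual ℝ Plane (q (v y) • gradient v y) = q (v y) • fderiv ℝ v y := by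
    rw [map_smulₛₗ]; simp [gradient]
  rw [e]; exact h1

lemma integrableOn_kern_gradient (h : IsProfile f v) (x : Plane) :
    IntegrableOn (fun y => f (v y) * (‖gradient v y‖ * ‖x - y‖⁻¹)) (lev v 0) := by
  obtain ⟨C, hC⟩ := h.grad_bdd
  obtain ⟨M, hM, hvM⟩ := h.exists_bound
  have hi := (integrableOn_inv_norm_sub (h.volume_lev_ne_top le_rfl) x).const_mul (f M * C)
  refine hi.mono' ?_ ?_
  · have hg := (measurable_gradient v).norm
    have hf := h.f_cont.measurable.comp h.cont.measurable
    exact (hf.mul (hg.mul (measurable_const.sub measurable_id).norm.inv)).aestronglyMeasurable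
  · filter_upwards [ae_restrict_mem (h.measurableSet_lev 0)] with y hy
    have h1 := h.f_nonneg y
    have h2 := h.f_mono (hvM y)
    rw [Real.norm_of_nonneg (by positivity), norm_sub_rev x y, mul_assoc]
    have := hC y hy
    have hfM : 0 ≤ f M := h1.trans h2
    gcongr

/-- The potential representation of `F(v)`, truncated above the level of `v x`. -/
lemma representation (h : IsProfile f v) {x : Plane} (hx : 0 < v x) :
    ∫ y in lev v 0, {y | v y < v x}.indicator (fun y => f (v y) * kern (gradient v y) (x - y)) y
      = 2 * π * ∫ τ in (0 : ℝ)..v x, f τ := by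
  set q : ℕ → ℝ → ℝ := fun n t => f t * ramp n t * ramp n (v x - t) with hq
  have hqc : ∀ n, Continuous (q n) := fun n =>
    (h.f_cont.mul (continuous_ramp n)).mul ((continuous_ramp n).comp (by fun_prop))
  have hδ : ∀ n : ℕ, (0 : ℝ) < 1 / (n + 1) := fun n => by positivity
  have hq0 : ∀ n : ℕ, ∀ t ≤ 1 / ((n : ℝ) + 1), q n t = 0 := fun n t ht => by
    simp [hq, ramp_eq_zero ht]
  have hqb : ∀ n t, |q n t| ≤ |f t| := fun n t => by
    simp only [hq, abs_mul]
    calc |f t| * |ramp n t| * |ramp n (v x - t)| ≤ |f t| * 1 * 1 := by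
          gcongr <;> exact abs_ramp_le_one _ _
      _ = |f t| := by ring
  have hrep : ∀ n, ∫ y in lev v 0, q n (v y) * kern (gradient v y) (x - y)
      = 2 * π * ∫ τ in (0 : ℝ)..v x, q n τ := by
    intro n
    rw [setIntegral_eq_integral_of_forall_compl_eq_zero fun y hy => by
      rw [hq0 n _ ((not_lt.1 hy).trans (hδ n).le), zero_mul]]
    simp only [← kern_smul]
    refine integral_kern_gradient (h.hasGradientAt_primitive (hqc n) (hδ n) (hq0 n))
      (h.continuous_cutoff (hqc n) (hδ n) (hq0 n) h.continuousOn_gradient)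
      (h.supp.comp_left (g := fun t => ∫ τ in (0 : ℝ)..t, q n τ) (by simp))
      (h.hasCompactSupport_cutoff (hq0 n 0 (hδ n).le) _) x
  have hL : Tendsto (fun n => ∫ y in lev v 0, q n (v y) * kern (gradient v y) (x - y)) atTop
      (𝓝 (∫ y in lev v 0,
        {y | v y < v x}.indicator (fun y => f (v y) * kern (gradient v y) (x - y)) y)) := by
    have hk : Measurable fun y => kern (gradient v y) (x - y) := by
      have := measurable_gradient v
      unfold kern; fun_prop
    refine tendsto_integral_of_dominated_convergence _ (fun n => ?_)
      (h.integrableOn_kern_gradient x) (fun n => ae_of_all _ fun y => ?_) ?_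
    · exact (((hqc n).measurable.comp h.cont.measurable).mul hk).aestronglyMeasurable
    · rw [norm_mul]
      refine mul_le_mul ?_ (abs_kern_le _ _) (norm_nonneg _) (h.f_nonneg y)
      exact (hqb n _).trans_eq (abs_of_nonneg (h.f_nonneg y))
    · filter_upwards [ae_restrict_mem (h.measurableSet_lev 0)] with y hy
      by_cases hyx : v y < v x
      · rw [indicator_of_mem (show y ∈ {y | v y < v x} from hyx)]
        simpa [hq] using ((((tendsto_ramp hy).const_mul (f (v y))).mul
          (tendsto_ramp (sub_pos.2 hyx))).mul_const (kern (gradient v y) (x - y)))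
      · rw [indicator_of_notMem (show y ∉ {y | v y < v x} from hyx)]
        have : ∀ n, q n (v y) = 0 := fun n => by
          simp [hq, ramp_eq_zero_of_nonpos (sub_nonpos.2 (not_lt.1 hyx))]
        simp [this]
  have hR : Tendsto (fun n => 2 * π * ∫ τ in (0 : ℝ)..v x, q n τ) atTop
      (𝓝 (2 * π * ∫ τ in (0 : ℝ)..v x, f τ)) := by
    refine Tendsto.const_mul _ (intervalIntegral.tendsto_integral_filter_of_dominated_convergence
      (fun t => |f t|) (Eventually.of_forall fun n => (hqc n).aestronglyMeasurable)
      (Eventually.of_forall fun n => ae_of_all _ fun t _ => hqb n t)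
      (h.f_cont.abs.intervalIntegrable _ _) ?_)
    have hne : ∀ᵐ t : ℝ, t ≠ v x := by simp [ae_iff]
    filter_upwards [hne] with t ht htx
    rw [uIoc_of_le hx.le] at htx
    simpa [hq] using ((tendsto_ramp htx.1).const_mul (f t)).mul
      (tendsto_ramp (sub_pos.2 (lt_of_le_of_ne htx.2 ht)))
  exact tendsto_nhds_unique hL (hR.congr fun n => (hrep n).symm)

end IsProfile

/-- The Newtonian-type kernel `‖x - y‖⁻¹` is integrable on products of sets of finite area. -/
lemma integrable_prod_inv_norm_sub {A : Set Plane} (hA : volume A ≠ ⊤) :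
    Integrable (fun z : Plane × Plane => ‖z.1 - z.2‖⁻¹)
      ((volume.restrict A).prod (volume.restrict A)) := by
  have hm : Measurable fun z : Plane × Plane => ‖z.1 - z.2‖⁻¹ :=
    (measurable_fst.sub measurable_snd).norm.inv
  have : IsFiniteMeasure (volume.restrict A) := ⟨by simpa using hA.lt_top⟩
  rw [integrable_prod_iff' hm.aestronglyMeasurable]
  refine ⟨ae_of_all _ fun y => integrableOn_inv_norm_sub hA y, ?_⟩
  refine Integrable.of_bound (C := volume.real A + π)
    hm.norm.aestronglyMeasurable.prod_swap.integral_prod_right' (ae_of_all _ fun y => ?_)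
  simp only [norm_inv, norm_norm]
  rw [Real.norm_of_nonneg (integral_nonneg fun x => by positivity)]
  exact setIntegral_inv_norm_sub_le hA y

namespace IsProfile

open Topology
open scoped RealInnerProductSpace

variable {f : ℝ → ℝ} {v : Plane → ℝ}

lemma measurable_area (h : IsProfile f v) : Measurable (area v) := by
  have hS : MeasurableSet {z : ℝ × Plane | z.1 < v z.2} :=
    measurableSet_lt measurable_fst (h.cont.measurable.comp measurable_snd)
  exact (measurable_measure_prodMk_left hS).ennreal_toReal

lemma mul_area_le_mass (h : IsProfile f v) {t : ℝ} (ht : 0 ≤ t) :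
    f t * area v t ≤ mass f v t := by
  have h1 : ∫ _ in lev v t, f t = f t * area v t := by
    rw [setIntegral_const, smul_eq_mul, mul_comm]; rfl
  rw [← h1]
  exact setIntegral_mono_on (integrableOn_const (h.volume_lev_ne_top ht))
    h.integrable_f.integrableOn (h.measurableSet_lev t) fun x hx => h.f_mono (le_of_lt hx)

lemma area_pos (h : IsProfile f v) {t : ℝ} (ht : 0 ≤ t) (hne : (lev v t).Nonempty) :
    0 < area v t :=
  ENNReal.toReal_pos ((h.isOpen_lev t).measure_pos volume hne).ne' (h.volume_lev_ne_top ht)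

lemma mass_pos (h : IsProfile f v) {t : ℝ} (ht : 0 < t) (hne : (lev v t).Nonempty) :
    0 < mass f v t :=
  (mul_pos (h.f_pos t ht) (h.area_pos ht.le hne)).trans_le (h.mul_area_le_mass ht.le)

lemma integrable_prod_kern (h : IsProfile f v) :
    Integrable (fun z : Plane × Plane => {z : Plane × Plane | v z.2 < v z.1}.indicator
      (fun z => f (v z.2) * kern (gradient v z.2) (z.1 - z.2)) z)
      ((volume.restrict (lev v 0)).prod (volume.restrict (lev v 0))) := by
  obtain ⟨C, hC⟩ := h.grad_bdd
  obtain ⟨M, hM, hvM⟩ := h.exists_bound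
  have hk : Measurable fun z : Plane × Plane => kern (gradient v z.2) (z.1 - z.2) := by
    have := measurable_gradient v
    unfold kern; fun_prop
  have hS : MeasurableSet {z : Plane × Plane | v z.2 < v z.1} :=
    measurableSet_lt (h.cont.measurable.comp measurable_snd) (h.cont.measurable.comp measurable_fst)
  have hf : Measurable fun z : Plane × Plane => f (v z.2) :=
    h.f_cont.measurable.comp (h.cont.measurable.comp measurable_snd)
  refine ((integrable_prod_inv_norm_sub (h.volume_lev_ne_top le_rfl)).const_mul (f M * C)).mono'
    ((hf.mul hk).indicator hS).aestronglyMeasurable ?_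
  rw [Measure.prod_restrict]
  filter_upwards [ae_restrict_mem ((h.measurableSet_lev 0).prod (h.measurableSet_lev 0))] with z hz
  refine (norm_indicator_le_norm_self _ _).trans ?_
  have h1 := h.f_nonneg z.2
  have h2 := h.f_mono (hvM z.2)
  have hfM : 0 ≤ f M := h1.trans h2
  have h3 := hC z.2 hz.2
  rw [norm_mul, Real.norm_of_nonneg h1, mul_assoc]
  calc f (v z.2) * ‖kern (gradient v z.2) (z.1 - z.2)‖
      ≤ f M * (‖gradient v z.2‖ * ‖z.1 - z.2‖⁻¹) := by gcongr; exact abs_kern_le _ _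
    _ ≤ f M * (C * ‖z.1 - z.2‖⁻¹) := by gcongr

/-- The flux-type quantity obtained by integrating the potential representation. -/
def flux (f : ℝ → ℝ) (v : Plane → ℝ) (y : Plane) : ℝ :=
  f (v y) * ∫ x in lev v (v y), kern (gradient v y) (x - y)

lemma inner_integral_eq_flux (h : IsProfile f v) {y : Plane} (hy : 0 < v y) :
    ∫ x in lev v 0, {z : Plane × Plane | v z.2 < v z.1}.indicator
      (fun z => f (v z.2) * kern (gradient v z.2) (z.1 - z.2)) (x, y) = flux f v y := by
  have h1 : ∀ x, {z : Plane × Plane | v z.2 < v z.1}.indicator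
      (fun z => f (v z.2) * kern (gradient v z.2) (z.1 - z.2)) (x, y)
      = (lev v (v y)).indicator (fun x => f (v y) * kern (gradient v y) (x - y)) x := fun x => rfl
  simp only [h1]
  rw [setIntegral_indicator (h.measurableSet_lev _), inter_eq_self_of_subset_right
    (lev_anti v hy.le), integral_const_mul]
  rfl

lemma integrableOn_flux (h : IsProfile f v) : IntegrableOn (flux f v) (lev v 0) := by
  refine (h.integrable_prod_kern.integral_prod_right).congr ?_
  filter_upwards [ae_restrict_mem (h.measurableSet_lev 0)] with y hy
  exact h.inner_integral_eq_flux hy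

lemma integral_flux (h : IsProfile f v) :
    ∫ y in lev v 0, flux f v y = 2 * π * ∫ x in lev v 0, ∫ τ in (0 : ℝ)..v x, f τ := by
  rw [← integral_const_mul]
  calc ∫ y in lev v 0, flux f v y
      = ∫ y in lev v 0, ∫ x in lev v 0, {z : Plane × Plane | v z.2 < v z.1}.indicator
          (fun z => f (v z.2) * kern (gradient v z.2) (z.1 - z.2)) (x, y) :=
        setIntegral_congr_fun (h.measurableSet_lev 0) fun y hy =>
          (h.inner_integral_eq_flux hy).symm
    _ = ∫ x in lev v 0, ∫ y in lev v 0, {z : Plane × Plane | v z.2 < v z.1}.indicator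
          (fun z => f (v z.2) * kern (gradient v z.2) (z.1 - z.2)) (x, y) :=
        (integral_integral_swap h.integrable_prod_kern).symm
    _ = _ := setIntegral_congr_fun (h.measurableSet_lev 0) fun x hx => h.representation hx

/-- The pointwise majorant of `flux`. -/
def fluxBound (f : ℝ → ℝ) (v : Plane → ℝ) (y : Plane) : ℝ :=
  π * (‖gradient v y‖ ^ 2 * (f (v y) * area v (v y) / mass f v (v y)))
    + f (v y) * mass f v (v y) / 4

/-- The radius of the disk with the same area as `{t < v}`. -/
def rad (v : Plane → ℝ) (t : ℝ) : ℝ := √(area v t / π)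

lemma area_eq_rad (v : Plane → ℝ) (t : ℝ) : area v t = π * rad v t ^ 2 := by
  have h0 : 0 ≤ area v t / π := div_nonneg ENNReal.toReal_nonneg pi_pos.le
  rw [rad, sq_sqrt h0]
  field_simp

lemma rad_pos (h : IsProfile f v) {t : ℝ} (ht : 0 ≤ t) (hne : (lev v t).Nonempty) :
    0 < rad v t := sqrt_pos.2 (div_pos (h.area_pos ht hne) pi_pos)

lemma volume_lev_eq (h : IsProfile f v) {t : ℝ} (ht : 0 ≤ t) :
    volume (lev v t) = ENNReal.ofReal (π * rad v t ^ 2) := by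
  rw [← area_eq_rad, area, ofReal_measureReal (h.volume_lev_ne_top ht)]

lemma flux_le (h : IsProfile f v) {y : Plane} (hy : 0 < v y) : flux f v y ≤ fluxBound f v y ∧
    (flux f v y = fluxBound f v y → (lev v (v y)).Nonempty → gradient v y ≠ 0 ∧
      2 * π * rad v (v y) * ‖gradient v y‖ = mass f v (v y) ∧
      lev v (v y) =ᵐ[volume] ball (y + rad v (v y) • (‖gradient v y‖⁻¹ • gradient v y))
        (rad v (v y))) := by
  rcases (lev v (v y)).eq_empty_or_nonempty with he | hne
  · refine ⟨?_, fun _ hne => absurd he hne.ne_empty⟩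
    have hm : mass f v (v y) = 0 := by simp [mass, he]
    simp [flux, fluxBound, he, hm]
  have hf := h.f_pos _ hy
  have hm := h.mass_pos hy hne
  have hr := h.rad_pos hy.le hne
  have hπ := pi_pos
  rcases eq_or_ne (gradient v y) 0 with hg | hg
  · have h0 : flux f v y = 0 := by simp [flux, hg, kern]
    have h1 : 0 < fluxBound f v y := by
      simp only [fluxBound, hg]
      have : 0 < f (v y) * mass f v (v y) := mul_pos hf hm
      simp; linarith
    exact ⟨by linarith, fun hh => by linarith⟩
  have hgn : 0 < ‖gradient v y‖ := norm_pos_iff.2 hg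
  set e : Plane := ‖gradient v y‖⁻¹ • gradient v y with he
  have he1 : ‖e‖ = 1 := by rw [he, norm_smul, norm_inv, norm_norm, inv_mul_cancel₀ hgn.ne']
  have hge : gradient v y = ‖gradient v y‖ • e := by rw [he, smul_inv_smul₀ hgn.ne']
  have key := setIntegral_kern_sub_le (h.measurableSet_lev (v y)) hr (h.volume_lev_eq hy.le) he1 y
  set J := ∫ x in lev v (v y), kern e (x - y) with hJ
  set r := rad v (v y)
  set g := ‖gradient v y‖ with hgdef
  set m := mass f v (v y)
  have hfl : flux f v y = f (v y) * (g * J) := by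
    rw [flux, hge]; simp only [kern_smul]; rw [integral_const_mul]
  have hb : fluxBound f v y = f (v y) * (g * (π * r)) + f (v y) * ((g * (π * r) - m / 2) ^ 2 / m) := by
    rw [fluxBound, area_eq_rad]
    change π * (g ^ 2 * (f (v y) * (π * r ^ 2) / m)) + f (v y) * m / 4 = _
    field_simp
    ring
  have hfg : 0 < f (v y) * g := mul_pos hf hgn
  have h1 : f (v y) * (g * J) ≤ f (v y) * (g * (π * r)) := by
    have := key.1
    gcongr
  have h2 : 0 ≤ f (v y) * ((g * (π * r) - m / 2) ^ 2 / m) := by positivity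
  refine ⟨by rw [hfl, hb]; linarith, fun heq _ => ?_⟩
  rw [hfl, hb] at heq
  have h3 : f (v y) * ((g * (π * r) - m / 2) ^ 2 / m) = 0 := by linarith
  have h4 : f (v y) * (g * J) = f (v y) * (g * (π * r)) := by linarith
  have h5 : J = π * r := mul_left_cancel₀ hgn.ne' (mul_left_cancel₀ hf.ne' h4)
  refine ⟨hg, ?_, key.2 h5⟩
  have h6 : g * (π * r) - m / 2 = 0 := by
    simpa [hf.ne', hm.ne'] using h3
  linarith

lemma ratio_mem (h : IsProfile f v) {t : ℝ} (ht : 0 ≤ t) :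
    0 ≤ f t * area v t / mass f v t ∧ f t * area v t / mass f v t ≤ 1 := by
  have hf : 0 ≤ f t := by have := h.f_mono ht; rwa [h.f_zero] at this
  exact ⟨div_nonneg (mul_nonneg hf ENNReal.toReal_nonneg) (h.mass_nonneg t),
    div_le_one_of_le₀ (h.mul_area_le_mass ht) (h.mass_nonneg t)⟩

lemma measurable_ratio (h : IsProfile f v) :
    Measurable fun t => f t * area v t / mass f v t :=
  (h.f_cont.measurable.mul h.measurable_area).div h.mass_anti.measurable

lemma integrableOn_gradient_sq_ratio (h : IsProfile f v) :
    IntegrableOn (fun y => ‖gradient v y‖ ^ 2 * (f (v y) * area v (v y) / mass f v (v y)))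
      (lev v 0) := by
  refine h.integrableOn_gradient_sq.mono' (((measurable_gradient v).norm.pow_const 2).mul
    (h.measurable_ratio.comp h.cont.measurable)).aestronglyMeasurable ?_
  filter_upwards [ae_restrict_mem (h.measurableSet_lev 0)] with y hy
  have := h.ratio_mem (le_of_lt hy : 0 ≤ v y)
  rw [norm_mul, Real.norm_of_nonneg (sq_nonneg _), Real.norm_of_nonneg this.1]
  exact mul_le_of_le_one_right (sq_nonneg _) this.2

lemma integral_gradient_sq_ratio (h : IsProfile f v) :
    ∫ y in lev v 0, ‖gradient v y‖ ^ 2 * (f (v y) * area v (v y) / mass f v (v y))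
      = ∫ x in lev v 0, ∫ τ in (0 : ℝ)..v x, f τ := by
  rw [h.coarea h.measurable_ratio]
  have h1 := h.integral_mul_setIntegral_lev (w := fun _ => 1) h.f_cont
    (integrableOn_const (h.volume_lev_ne_top le_rfl))
  simp only [one_mul] at h1
  rw [← h1]
  refine setIntegral_congr_fun measurableSet_Ioi fun t ht => ?_
  have h2 : ∫ _ in lev v t, (1 : ℝ) = area v t := by simp [area]
  simp only [h2]
  rcases (lev v t).eq_empty_or_nonempty with he | hne
  · simp [area, he]
  · have := (h.mass_pos ht hne).ne'
    field_simp

lemma integrableOn_mul_mass (h : IsProfile f v) :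
    IntegrableOn (fun y => f (v y) * mass f v (v y)) (lev v 0) := by
  refine (h.integrable_f.integrableOn.mul_const (mass f v 0)).mono'
    ((h.f_cont.measurable.comp h.cont.measurable).mul
      (h.mass_anti.measurable.comp h.cont.measurable)).aestronglyMeasurable
    (ae_of_all _ fun y => ?_)
  rw [norm_mul, Real.norm_of_nonneg (h.f_nonneg y), Real.norm_of_nonneg (h.mass_nonneg _)]
  exact mul_le_mul_of_nonneg_left (h.mass_anti (h.nonneg y)) (h.f_nonneg y)

lemma integral_mul_mass_le (h : IsProfile f v) :
    ∫ y in lev v 0, f (v y) * mass f v (v y) ≤ mass f v 0 ^ 2 / 2 := by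
  set μ := volume.restrict (lev v 0)
  have hfi : Integrable (fun x => f (v x)) μ := h.integrable_f.integrableOn
  set S : Set (Plane × Plane) := {z | v z.2 < v z.1} with hSdef
  have hS : MeasurableSet S :=
    measurableSet_lt (h.cont.measurable.comp measurable_snd) (h.cont.measurable.comp measurable_fst)
  have hP : Integrable (fun z : Plane × Plane => f (v z.1) * f (v z.2)) (μ.prod μ) := hfi.mul_prod hfi
  have hK := hP.indicator hS
  have e1 : ∫ y, f (v y) * mass f v (v y) ∂μ
      = ∫ z, S.indicator (fun z : Plane × Plane => f (v z.1) * f (v z.2)) z ∂(μ.prod μ) := by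
    rw [integral_prod_symm _ hK]
    refine setIntegral_congr_fun (h.measurableSet_lev 0) fun y hy => ?_
    have h1 : ∀ x, S.indicator (fun z : Plane × Plane => f (v z.1) * f (v z.2)) (x, y)
      = (lev v (v y)).indicator (fun x => f (v x) * f (v y)) x := fun x => rfl
    simp only [h1]
    rw [setIntegral_indicator (h.measurableSet_lev _), inter_eq_self_of_subset_right
      (lev_anti v (le_of_lt hy)), integral_mul_const, mul_comm]
    rfl
  have e2 : ∫ z, S.indicator (fun z : Plane × Plane => f (v z.1) * f (v z.2)) z ∂(μ.prod μ)
      = ∫ z, S.indicator (fun z : Plane × Plane => f (v z.1) * f (v z.2)) z.swap ∂(μ.prod μ) :=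
    (integral_prod_swap _).symm
  have e3 : ∫ z, f (v z.1) * f (v z.2) ∂(μ.prod μ) = mass f v 0 ^ 2 := by
    rw [integral_prod_mul (fun x => f (v x)) fun x => f (v x), sq]; rfl
  have hle : (∫ z, S.indicator (fun z : Plane × Plane => f (v z.1) * f (v z.2)) z ∂(μ.prod μ))
      + ∫ z, S.indicator (fun z : Plane × Plane => f (v z.1) * f (v z.2)) z.swap ∂(μ.prod μ)
      ≤ ∫ z, f (v z.1) * f (v z.2) ∂(μ.prod μ) := by
    have hKs : Integrable (fun z : Plane × Plane =>
      S.indicator (fun z : Plane × Plane => f (v z.1) * f (v z.2)) z.swap) (μ.prod μ) := hK.swap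
    rw [← integral_add hK hKs]
    refine integral_mono (hK.add hKs) hP fun z => ?_
    have h0 : 0 ≤ f (v z.1) * f (v z.2) := mul_nonneg (h.f_nonneg _) (h.f_nonneg _)
    simp only [indicator, hSdef, mem_ofPred_eq, Prod.fst_swap, Prod.snd_swap]
    split_ifs <;> nlinarith
  rw [e1]
  linarith

lemma integrableOn_fluxBound (h : IsProfile f v) : IntegrableOn (fluxBound f v) (lev v 0) :=
  (h.integrableOn_gradient_sq_ratio.const_mul π).add (h.integrableOn_mul_mass.div_const 4)

lemma integral_fluxBound (h : IsProfile f v) :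
    ∫ y in lev v 0, fluxBound f v y = π * (∫ x in lev v 0, ∫ τ in (0 : ℝ)..v x, f τ)
      + (∫ y in lev v 0, f (v y) * mass f v (v y)) / 4 := by
  unfold fluxBound
  rw [integral_add (h.integrableOn_gradient_sq_ratio.const_mul π)
    (h.integrableOn_mul_mass.div_const 4), integral_const_mul, h.integral_gradient_sq_ratio,
    integral_div]

/-- The sharp bound for the potential energy in terms of the mass. -/
theorem integral_primitive_le (h : IsProfile f v) :
    8 * π * ∫ x in lev v 0, ∫ τ in (0 : ℝ)..v x, f τ ≤ mass f v 0 ^ 2 := by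
  have h1 : ∫ y in lev v 0, flux f v y ≤ ∫ y in lev v 0, fluxBound f v y :=
    setIntegral_mono_on h.integrableOn_flux h.integrableOn_fluxBound (h.measurableSet_lev 0)
      fun y hy => (h.flux_le hy).1
  rw [h.integral_flux, h.integral_fluxBound] at h1
  linarith [h.integral_mul_mass_le]

lemma flux_eq_of_eq (h : IsProfile f v)
    (heq : 8 * π * ∫ x in lev v 0, ∫ τ in (0 : ℝ)..v x, f τ = mass f v 0 ^ 2) :
    ∀ᵐ y ∂volume.restrict (lev v 0), flux f v y = fluxBound f v y := by
  have hae : flux f v ≤ᵐ[volume.restrict (lev v 0)] fluxBound f v := by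
    filter_upwards [ae_restrict_mem (h.measurableSet_lev 0)] with y hy using (h.flux_le hy).1
  refine (integral_eq_iff_of_ae_le h.integrableOn_flux h.integrableOn_fluxBound hae).1
    (le_antisymm (integral_mono_ae h.integrableOn_flux h.integrableOn_fluxBound hae) ?_)
  rw [h.integral_flux, h.integral_fluxBound]
  linarith [h.integral_mul_mass_le]

/-- The Dirichlet energy by layers. -/
lemma integral_gradient_sq (h : IsProfile f v) :
    ∫ x in lev v 0, ‖gradient v x‖ ^ 2 = ∫ x in lev v 0, f (v x) * v x := by
  have h1 := h.coarea (q := fun _ => 1) measurable_const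
  have h2 := h.integral_mul_setIntegral_lev (q := fun _ => 1) continuous_const
    h.integrable_f.integrableOn
  simp only [mul_one, one_mul] at h1 h2
  rw [h1]
  refine Eq.trans h2 ?_
  simp

end IsProfile

lemma setIntegral_ball_id (c : Plane) (r : ℝ) :
    ∫ x in ball c r, x = volume.real (ball c r) • c := by
  have hi : IntegrableOn (fun x : Plane => x) (ball 0 r) :=
    (continuous_id.continuousOn.integrableOn_compact (isCompact_closedBall 0 r)).mono_set
      ball_subset_closedBall
  have h0 : ∫ x in ball (0 : Plane) r, x = 0 := by
    have h1 : ∫ x, (ball (0 : Plane) r).indicator (fun x => x) x = ∫ x, (ball (0 : Plane) r).indicator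
        (fun x => x) (-x) := (integral_neg_eq_self _ _).symm
    have h2 : ∀ x : Plane, (ball (0 : Plane) r).indicator (fun x => x) (-x)
        = -(ball (0 : Plane) r).indicator (fun x => x) x := fun x => by
      simp only [indicator, mem_ball_zero_iff, norm_neg]; split_ifs <;> simp
    simp only [h2, integral_neg] at h1
    rw [integral_indicator measurableSet_ball] at h1
    have h3 : (2 : ℝ) • ∫ x in ball (0 : Plane) r, x = 0 := by
      rw [two_smul]
      nth_rewrite 1 [h1]
      exact neg_add_cancel _
    exact (smul_eq_zero.1 h3).resolve_left two_ne_zero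
  have hpre : (fun x : Plane => x + c) ⁻¹' ball c r = ball 0 r := by
    ext x; simp [dist_eq_norm]
  rw [← (measurePreserving_add_right volume c).setIntegral_preimage_emb
    (measurableEmbedding_addRight c), hpre, integral_add hi
    (integrableOn_const (by finiteness)), h0, zero_add, setIntegral_const]
  congr 1
  rw [← hpre]
  exact (measurePreserving_add_right volume c).measureReal_preimage
    measurableSet_ball.nullMeasurableSet

lemma dist_le_of_ball_subset_ball {c c' : Plane} {r r' : ℝ} (hr : 0 < r)
    (hsub : ball c r ⊆ ball c' r') : dist c c' ≤ r' - r := by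
  obtain ⟨u, hu, hcu⟩ : ∃ u : Plane, ‖u‖ = 1 ∧ c - c' = dist c c' • u := by
    rcases eq_or_ne c c' with rfl | hne
    · exact ⟨EuclideanSpace.single 0 1, by simp, by simp⟩
    · have h0 : 0 < dist c c' := dist_pos.2 hne
      refine ⟨(dist c c')⁻¹ • (c - c'), ?_, (smul_inv_smul₀ h0.ne' _).symm⟩
      rw [norm_smul, ← dist_eq_norm, norm_inv, Real.norm_of_nonneg h0.le, inv_mul_cancel₀ h0.ne']
  have h1 : ∀ ρ ∈ Ioo 0 r, ρ ≤ r' - dist c c' := fun ρ hρ => by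
    have h2 : c + ρ • u ∈ ball c' r' := hsub (by
      simp [hu, norm_smul, abs_of_pos hρ.1, hρ.2])
    have h3 : c + ρ • u - c' = (dist c c' + ρ) • u := by rw [add_smul, ← hcu]; abel
    have h4 : 0 ≤ dist c c' + ρ := add_nonneg dist_nonneg hρ.1.le
    rw [mem_ball, dist_eq_norm, h3, norm_smul, hu, mul_one, Real.norm_of_nonneg h4] at h2
    linarith
  have h5 : r ≤ r' - dist c c' := by
    refine le_of_forall_lt_imp_le_of_dense fun ρ hρ => ?_
    exact (le_max_left ρ (r / 2)).trans
      (h1 _ ⟨(half_pos hr).trans_le (le_max_right _ _), max_lt hρ (half_lt_self hr)⟩)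
  linarith

namespace IsProfile

open Topology
open scoped RealInnerProductSpace

variable {f : ℝ → ℝ} {v : Plane → ℝ}

lemma continuousAt_setIntegral_lev (h : IsProfile f v) {E : Type*} [NormedAddCommGroup E]
    [NormedSpace ℝ E] {w : Plane → E} (hw : IntegrableOn w (lev v 0)) {t : ℝ} (ht : 0 < t)
    (hnull : ∀ᵐ x, v x ≠ t) : ContinuousAt (fun s => ∫ x in lev v s, w x) t := by
  simp only [← integral_indicator (h.measurableSet_lev _)]
  refine continuousAt_of_dominated (bound := fun x => ‖(lev v 0).indicator w x‖) ?_ ?_ ?_ ?_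
  · filter_upwards [lt_mem_nhds ht] with s hs
    exact ((integrable_indicator_iff (h.measurableSet_lev s)).2
      (hw.mono_set (lev_anti v hs.le))).aestronglyMeasurable
  · filter_upwards [lt_mem_nhds ht] with s hs
    exact ae_of_all _ fun x => norm_indicator_le_of_subset (lev_anti v hs.le) w x
  · exact ((integrable_indicator_iff (h.measurableSet_lev 0)).2 hw).norm
  · filter_upwards [hnull] with x hx
    refine continuousAt_const.congr (f := fun _ => (lev v t).indicator w x) ?_
    rcases lt_or_gt_of_ne hx with hlt | hgt
    · filter_upwards [lt_mem_nhds hlt] with s hs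
      rw [indicator_of_notMem (show x ∉ lev v t from not_lt.2 hlt.le),
        indicator_of_notMem (show x ∉ lev v s from not_lt.2 hs.le)]
    · filter_upwards [gt_mem_nhds hgt] with s hs
      rw [indicator_of_mem (show x ∈ lev v t from hgt), indicator_of_mem (show x ∈ lev v s from hs)]

/-- The centroid of the superlevel set `{t < v}`. -/
def centroid (v : Plane → ℝ) (t : ℝ) : Plane := (area v t)⁻¹ • ∫ x in lev v t, x

lemma centroid_eq (h : IsProfile f v) {t : ℝ} (ht : 0 ≤ t) (hne : (lev v t).Nonempty) {c : Plane}
    {r : ℝ} (hb : lev v t =ᵐ[volume] ball c r) : centroid v t = c := by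
  have h1 : area v t = volume.real (ball c r) := measureReal_congr hb
  rw [centroid, setIntegral_congr_set hb, setIntegral_ball_id, ← h1,
    inv_smul_smul₀ (ne_of_gt (h.area_pos ht hne))]

/-- The superlevel set bounded by the level set through `y` is, up to null sets, a disk tangent
at `y`, and the gradient at `y` is determined by its mass and area. -/
def IsCritical (f : ℝ → ℝ) (v : Plane → ℝ) (y : Plane) : Prop :=
  gradient v y ≠ 0 ∧ 2 * π * rad v (v y) * ‖gradient v y‖ = mass f v (v y) ∧
    lev v (v y) =ᵐ[volume] ball (y + rad v (v y) • (‖gradient v y‖⁻¹ • gradient v y))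
      (rad v (v y))

lemma IsCritical.lev_eq (h : IsProfile f v) {y : Plane} (hy : 0 < v y)
    (hne : (lev v (v y)).Nonempty) (hc : IsCritical f v y) :
    lev v (v y) =ᵐ[volume] ball (centroid v (v y)) (rad v (v y)) := by
  rw [h.centroid_eq hy.le hne hc.2.2]
  exact hc.2.2

lemma IsCritical.gradient_eq (h : IsProfile f v) {y : Plane} (hy : 0 < v y)
    (hne : (lev v (v y)).Nonempty) (hc : IsCritical f v y) :
    gradient v y = (mass f v (v y) / (2 * area v (v y))) • (centroid v (v y) - y) := by
  have hr := h.rad_pos hy.le hne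
  have hg : 0 < ‖gradient v y‖ := norm_pos_iff.2 hc.1
  have hπ := pi_pos
  rw [h.centroid_eq hy.le hne hc.2.2, add_sub_cancel_left, smul_smul, smul_smul, area_eq_rad,
    ← hc.2.1]
  have : 2 * π * rad v (v y) * ‖gradient v y‖ / (2 * (π * rad v (v y) ^ 2)) * rad v (v y) *
      ‖gradient v y‖⁻¹ = 1 := by
    field_simp
  rw [this, one_smul]

end IsProfile

/-- A profile, with maximum value `M`, attaining equality in the flux bound. -/
structure IsExtremal (f : ℝ → ℝ) (v : Plane → ℝ) (M : ℝ) : Prop extends IsProfile f v where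
  le_max : ∀ x, v x ≤ M
  max_pos : 0 < M
  exists_max : ∃ x, v x = M
  ae_critical : ∀ᵐ y ∂volume.restrict (lev v 0), (lev v (v y)).Nonempty → IsProfile.IsCritical f v y

namespace IsExtremal

open Topology IsProfile
open scoped RealInnerProductSpace

variable {f : ℝ → ℝ} {v : Plane → ℝ} {M : ℝ}

lemma lev_nonempty (h : IsExtremal f v M) {t : ℝ} (ht : t < M) : (lev v t).Nonempty := by
  obtain ⟨x, hx⟩ := h.exists_max
  exact ⟨x, by rw [← hx] at ht; exact ht⟩

lemma ae_critical' (h : IsExtremal f v M) :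
    ∀ᵐ y, 0 < v y → v y < M → IsCritical f v y := by
  have := (ae_restrict_iff' (h.measurableSet_lev 0)).1 h.ae_critical
  filter_upwards [this] with y hy h0 hM using hy h0 (h.lev_nonempty hM)

lemma ae_ne (h : IsExtremal f v M) {t : ℝ} (ht : t ∈ Ioo 0 M) : ∀ᵐ x, v x ≠ t := by
  have hq : Measurable (({t} : Set ℝ).indicator fun _ => (1 : ℝ)) :=
    measurable_const.indicator (measurableSet_singleton t)
  have h1 := h.coarea hq
  have h2 : ∫ s in Ioi (0 : ℝ), mass f v s * ({t} : Set ℝ).indicator (fun _ => (1 : ℝ)) s = 0 := by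
    refine integral_eq_zero_of_ae (ae_restrict_of_ae ?_)
    have hne : ∀ᵐ s : ℝ, s ≠ t := by simp [ae_iff]
    filter_upwards [hne] with s hs
    simp [hs]
  rw [h2, integral_eq_zero_iff_of_nonneg] at h1
  · have h3 := (ae_restrict_iff' (h.measurableSet_lev 0)).1 h1
    filter_upwards [h3, h.ae_critical'] with y hy hc hvt
    have h4 := hy (show 0 < v y by rw [hvt]; exact ht.1)
    have h5 := (hc (by rw [hvt]; exact ht.1) (by rw [hvt]; exact ht.2)).1
    simp [hvt, h5] at h4
  · exact fun y => mul_nonneg (sq_nonneg _) (indicator_nonneg (fun _ _ => zero_le_one) _)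
  · refine h.integrableOn_gradient_sq.mono' (((measurable_gradient v).norm.pow_const 2).mul
      (hq.comp h.cont.measurable)).aestronglyMeasurable (ae_of_all _ fun y => ?_)
    rw [norm_mul, Real.norm_of_nonneg (sq_nonneg _)]
    refine mul_le_of_le_one_right (sq_nonneg _) ((norm_indicator_le_norm_self _ _).trans ?_)
    simp

lemma exists_mem_Ioo (h : IsExtremal f v M) {a b : ℝ} (ha : 0 ≤ a) (hab : a < b) (hb : b ≤ M) :
    ∃ y, v y ∈ Ioo a b ∧ IsCritical f v y := by
  obtain ⟨x, hx⟩ := h.exists_max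
  obtain ⟨z, hz⟩ : ∃ z, z ∉ tsupport v := by
    by_contra! hcon
    exact h.supp.isCompact.ne_univ (eq_univ_of_forall hcon)
  have hz0 : v z = 0 := image_eq_zero_of_notMem_tsupport hz
  obtain ⟨w, hw⟩ := mem_range_of_exists_le_of_exists_ge h.cont
    (c := (a + b) / 2) ⟨z, by rw [hz0]; linarith⟩ ⟨x, by rw [hx]; linarith⟩
  have hU : IsOpen (v ⁻¹' Ioo a b) := isOpen_Ioo.preimage h.cont
  have hne : (v ⁻¹' Ioo a b).Nonempty := ⟨w, by
    rw [mem_preimage, hw]; constructor <;> linarith⟩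
  by_contra! hcon
  refine (hU.measure_pos volume hne).ne' (measure_mono_null (fun y hy => ?_)
    (ae_iff.1 h.ae_critical'))
  simp only [mem_ofPred_eq, not_forall]
  exact ⟨ha.trans_lt hy.1, hy.2.trans_le hb, hcon y hy⟩

lemma continuousAt_area (h : IsExtremal f v M) {t : ℝ} (ht : t ∈ Ioo 0 M) :
    ContinuousAt (area v) t := by
  have := h.continuousAt_setIntegral_lev (w := fun _ => (1 : ℝ))
    (integrableOn_const (h.volume_lev_ne_top le_rfl)) ht.1 (h.ae_ne ht)
  simp only [setIntegral_const, smul_eq_mul, mul_one] at this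
  exact this

lemma continuousAt_rad (h : IsExtremal f v M) {t : ℝ} (ht : t ∈ Ioo 0 M) :
    ContinuousAt (rad v) t := ((h.continuousAt_area ht).div_const π).sqrt

lemma continuousAt_mass (h : IsExtremal f v M) {t : ℝ} (ht : t ∈ Ioo 0 M) :
    ContinuousAt (mass f v) t :=
  h.continuousAt_setIntegral_lev h.integrable_f.integrableOn ht.1 (h.ae_ne ht)

lemma continuousAt_centroid (h : IsExtremal f v M) {t : ℝ} (ht : t ∈ Ioo 0 M) :
    ContinuousAt (centroid v) t := by
  have hi : IntegrableOn (fun x : Plane => x) (lev v 0) :=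
    (continuous_id.continuousOn.integrableOn_compact h.supp.isCompact).mono_set
      (lev_subset_tsupport le_rfl)
  exact ((h.continuousAt_area ht).inv₀ (h.area_pos ht.1.le (h.lev_nonempty ht.2)).ne').smul
    (h.continuousAt_setIntegral_lev hi ht.1 (h.ae_ne ht))

lemma gradient_eq (h : IsExtremal f v M) {y : Plane} (hy : v y ∈ Ioo 0 M) :
    gradient v y = (mass f v (v y) / (2 * area v (v y))) • (centroid v (v y) - y) := by
  have hU : IsOpen (v ⁻¹' Ioo 0 M) := isOpen_Ioo.preimage h.cont
  have hsub : v ⁻¹' Ioo 0 M ⊆ lev v 0 := fun y hy => hy.1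
  refine Measure.eqOn_open_of_ae_eq (μ := volume) (U := v ⁻¹' Ioo 0 M) (f := gradient v)
    (g := fun y => (mass f v (v y) / (2 * area v (v y))) • (centroid v (v y) - y))
    ?_ hU (h.continuousOn_gradient.mono hsub) ?_ hy
  · filter_upwards [ae_restrict_mem hU.measurableSet, ae_restrict_of_ae h.ae_critical'] with y hy hc
    exact (hc hy.1 hy.2).gradient_eq h.toIsProfile hy.1 (h.lev_nonempty hy.2)
  · intro y hy
    have hv := h.cont.continuousAt (x := y)
    have ha := (h.area_pos (le_of_lt hy.1) (h.lev_nonempty hy.2)).ne'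
    have h1 := ContinuousAt.comp (f := v) (h.continuousAt_mass hy) hv
    have h2 := ContinuousAt.comp (f := v) (h.continuousAt_area hy) hv
    have h3 := ContinuousAt.comp (f := v) (h.continuousAt_centroid hy) hv
    exact ((h1.div (h2.const_mul 2) (mul_ne_zero two_ne_zero ha)).smul
      (h3.sub continuousAt_id)).continuousWithinAt

lemma lev_eq_ball (h : IsExtremal f v M) {t : ℝ} (ht : t ∈ Ioo 0 M) :
    lev v t = ball (centroid v t) (rad v t) := by
  have hcr : ContinuousAt (fun s => (centroid v s, rad v s)) t :=
    (h.continuousAt_centroid ht).prodMk (h.continuousAt_rad ht)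
  have hfreq : ∃ᶠ s in 𝓝[>] t, ∃ y, v y = s ∧ s < M ∧ IsCritical f v y := by
    rw [frequently_nhdsWithin_iff, frequently_nhds_iff]
    intro U htU hU
    obtain ⟨b, hb, hbU⟩ := exists_Ico_subset_of_mem_nhds (hU.mem_nhds htU) ⟨M, ht.2⟩
    obtain ⟨y, hy, hc⟩ := h.exists_mem_Ioo ht.1.le (lt_min hb ht.2) (min_le_right b M)
    exact ⟨v y, hbU ⟨hy.1.le, hy.2.trans_le (min_le_left _ _)⟩, ⟨y, rfl,
      hy.2.trans_le (min_le_right _ _), hc⟩, hy.1⟩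
  have hle : 𝓝[>] t ≤ 𝓝 t := nhdsWithin_le_nhds
  apply Subset.antisymm
  · rw [← interior_closedBall _ (h.rad_pos ht.1.le (h.lev_nonempty ht.2)).ne']
    refine interior_maximal (fun x hx => ?_) (h.isOpen_lev t)
    by_contra hcon
    rw [mem_closedBall, not_le] at hcon
    have hev : ∀ᶠ s in 𝓝 t, rad v s < dist x (centroid v s) :=
      (h.continuousAt_rad ht).eventually_lt (continuousAt_const.dist (h.continuousAt_centroid ht))
        hcon
    obtain ⟨s, ⟨y, rfl, hyM, hc⟩, hs1, hs2, hs3⟩ := (hfreq.and_eventually ((hev.filter_mono hle).and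
      ((((gt_mem_nhds hx).filter_mono hle)).and self_mem_nhdsWithin))).exists
    have hy0 : 0 < v y := ht.1.trans hs3
    have hae := hc.lev_eq h.toIsProfile hy0 (h.lev_nonempty hyM)
    have hO : IsOpen (lev v (v y) \ closedBall (centroid v (v y)) (rad v (v y))) :=
      (h.isOpen_lev _).sdiff isClosed_closedBall
    refine (hO.measure_pos volume ⟨x, hs2, by simpa using hs1⟩).ne' ?_
    exact measure_mono_null (sdiff_subset_sdiff_right ball_subset_closedBall)
      (ae_le_set.1 hae.le)
  · intro x hx
    have hev : ∀ᶠ s in 𝓝 t, dist x (centroid v s) < rad v s :=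
      (continuousAt_const.dist (h.continuousAt_centroid ht)).eventually_lt (h.continuousAt_rad ht)
        hx
    obtain ⟨s, ⟨y, rfl, hyM, hc⟩, hs1, hs3⟩ := (hfreq.and_eventually ((hev.filter_mono hle).and
      self_mem_nhdsWithin)).exists
    have hy0 : 0 < v y := ht.1.trans hs3
    have hae := hc.lev_eq h.toIsProfile hy0 (h.lev_nonempty hyM)
    refine lt_of_lt_of_le hs3 (not_lt.1 fun hxy => ?_)
    have hO : IsOpen (ball (centroid v (v y)) (rad v (v y)) ∩ {x | v x < v y}) :=
      isOpen_ball.inter (isOpen_lt h.cont continuous_const)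
    refine (hO.measure_pos volume ⟨x, hs1, hxy⟩).ne' ?_
    have hsub : ball (centroid v (v y)) (rad v (v y)) ∩ {x | v x < v y} ⊆
        ball (centroid v (v y)) (rad v (v y)) \ lev v (v y) :=
      fun z hz => ⟨hz.1, fun hzl : v y < v z => lt_asymm hzl hz.2⟩
    exact measure_mono_null hsub (ae_le_set.1 hae.symm.le)

lemma apply_of_dist_eq (h : IsExtremal f v M) {t : ℝ} (ht : t ∈ Ioo 0 M) {z : Plane}
    (hz : dist z (centroid v t) = rad v t) : v z = t := by
  have hr := h.rad_pos ht.1.le (h.lev_nonempty ht.2)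
  have hb := h.lev_eq_ball ht
  refine le_antisymm (not_lt.1 fun hlt => ?_) ?_
  · have : z ∈ ball (centroid v t) (rad v t) := hb ▸ hlt
    exact absurd hz (ne_of_lt this)
  · have hcl : z ∈ closure (lev v t) := by
      rw [hb, closure_ball _ hr.ne']; exact hz.le
    exact closure_minimal (fun x hx => le_of_lt hx) (isClosed_le continuous_const h.cont) hcl

lemma dist_centroid_le (h : IsExtremal f v M) {s t : ℝ} (hs : s ∈ Ioo 0 M) (ht : t ∈ Ioo 0 M) :
    dist (centroid v s) (centroid v t) ≤ |rad v s - rad v t| := by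
  wlog hst : t ≤ s generalizing s t
  · rw [dist_comm, abs_sub_comm]
    exact this ht hs (le_of_not_ge hst)
  have h1 := dist_le_of_ball_subset_ball (h.rad_pos hs.1.le (h.lev_nonempty hs.2))
    (h.lev_eq_ball hs ▸ h.lev_eq_ball ht ▸ lev_anti v hst)
  rw [abs_sub_comm]
  exact h1.trans (le_abs_self _)

/-- First-order expansion of `v` along a moving boundary point of its superlevel disks. -/
lemma isLittleO_boundary (h : IsExtremal f v M) {t : ℝ} (ht : t ∈ Ioo 0 M) {e : Plane}
    (he : ‖e‖ = 1) :
    (fun s => (s - t) + mass f v t / (2 * area v t) * rad v t *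
      ((rad v s - rad v t) + ⟪e, centroid v s - centroid v t⟫))
      =o[𝓝 t] fun s => rad v s - rad v t := by
  set z : ℝ → Plane := fun s => centroid v s + rad v s • e with hz
  have hdist : ∀ s ∈ Ioo 0 M, dist (z s) (centroid v s) = rad v s := fun s hs => by
    simp [hz, norm_smul, he, abs_of_pos (h.rad_pos hs.1.le (h.lev_nonempty hs.2))]
  have hvz : ∀ s ∈ Ioo 0 M, v (z s) = s := fun s hs => h.apply_of_dist_eq hs (hdist s hs)
  have hzt : ContinuousAt z t :=
    (h.continuousAt_centroid ht).add ((h.continuousAt_rad ht).smul continuousAt_const)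
  have hg : HasGradientAt v (gradient v (z t)) (z t) :=
    (h.differentiableAt (by rw [hvz t ht]; exact ht.1)).hasGradientAt
  have h1 := (hasGradientAt_iff_isLittleO.1 hg).comp_tendsto hzt
  have hev : ∀ᶠ s in 𝓝 t, s ∈ Ioo 0 M := Ioo_mem_nhds ht.1 ht.2
  have h2 : (fun s => z s - z t) =O[𝓝 t] fun s => rad v s - rad v t := by
    refine Asymptotics.IsBigO.of_bound 2 ?_
    filter_upwards [hev] with s hs
    have e1 : z s - z t = (centroid v s - centroid v t) + (rad v s - rad v t) • e := by
      simp only [hz, sub_smul]; abel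
    rw [e1]
    refine (norm_add_le _ _).trans ?_
    rw [norm_smul, he, ← dist_eq_norm, Real.norm_eq_abs]
    linarith [h.dist_centroid_le hs ht]
  refine (h1.trans_isBigO h2).congr' ?_ EventuallyEq.rfl
  filter_upwards [hev] with s hs
  have e1 : z s - z t = (centroid v s - centroid v t) + (rad v s - rad v t) • e := by
    simp only [hz, sub_smul]; abel
  have e2 : gradient v (z t) = -((mass f v t / (2 * area v t) * rad v t) • e) := by
    rw [h.gradient_eq (by rw [hvz t ht]; exact ht), hvz t ht, mul_smul, ← smul_neg]
    congr 1
    simp [hz]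
  simp only [Function.comp_apply]
  rw [hvz s hs, hvz t ht, e1, e2, inner_neg_left, inner_smul_left, inner_add_right,
    inner_smul_right, real_inner_self_eq_norm_sq, he]
  simp only [conj_trivial]
  ring

lemma hasDerivAt_inner_centroid (h : IsExtremal f v M) {t : ℝ} (ht : t ∈ Ioo 0 M) {e : Plane}
    (he : ‖e‖ = 1) : HasDerivAt (fun s => ⟪e, centroid v s⟫) 0 t := by
  have hne := h.lev_nonempty ht.2
  set k := mass f v t / (2 * area v t) * rad v t with hk
  have hk0 : 0 < k := mul_pos (div_pos (h.mass_pos ht.1 hne) (mul_pos two_pos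
    (h.area_pos ht.1.le hne))) (h.rad_pos ht.1.le hne)
  have h1 := h.isLittleO_boundary ht he
  have h2 := h.isLittleO_boundary ht (e := -e) (by rwa [norm_neg])
  have hsum := (h1.add h2).const_mul_left (1 / 2)
  have hdiff := (h1.sub h2).const_mul_left (1 / (2 * k))
  have hO : (fun s => rad v s - rad v t) =O[𝓝 t] fun s => s - t := by
    refine Asymptotics.IsBigO.of_bound (2 / k) ?_
    filter_upwards [hsum.bound (half_pos hk0)] with s hs
    simp only [inner_neg_left] at hs
    have e1 : 1 / 2 * ((s - t) + k * ((rad v s - rad v t) + ⟪e, centroid v s - centroid v t⟫) +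
        ((s - t) + k * ((rad v s - rad v t) + -⟪e, centroid v s - centroid v t⟫)))
        = k * (rad v s - rad v t) + (s - t) := by ring
    rw [e1] at hs
    have h3 : k * ‖rad v s - rad v t‖ ≤ ‖k * (rad v s - rad v t) + (s - t)‖ + ‖s - t‖ := by
      have := norm_sub_le (k * (rad v s - rad v t) + (s - t)) (s - t)
      rwa [add_sub_cancel_right, norm_mul, Real.norm_of_nonneg hk0.le] at this
    rw [div_mul_eq_mul_div, le_div_iff₀ hk0]
    linarith
  rw [hasDerivAt_iff_isLittleO]
  refine (hdiff.trans_isBigO hO).congr_left fun s => ?_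
  simp only [inner_neg_left, inner_sub_right, smul_zero, sub_zero]
  field_simp
  ring

lemma centroid_eq_centroid (h : IsExtremal f v M) {s t : ℝ} (hs : s ∈ Ioo 0 M)
    (ht : t ∈ Ioo 0 M) : centroid v s = centroid v t := by
  have key : ∀ e : Plane, ‖e‖ = 1 → ⟪e, centroid v s⟫ = ⟪e, centroid v t⟫ := fun e he =>
    isOpen_Ioo.is_const_of_deriv_eq_zero isPreconnected_Ioo (s := Ioo 0 M)
      (f := fun s => ⟪e, centroid v s⟫)
      (fun τ hτ => (h.hasDerivAt_inner_centroid hτ he).differentiableAt.differentiableWithinAt)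
      (fun τ hτ => (h.hasDerivAt_inner_centroid hτ he).deriv) hs ht
  ext i
  simpa [EuclideanSpace.inner_single_left] using key (EuclideanSpace.single i 1) (by simp)

/-- The positivity set of an extremal profile is a disk, on which the profile is radial. -/
theorem exists_ball (h : IsExtremal f v M) : ∃ (c : Plane) (r : ℝ), 0 < r ∧ lev v 0 = ball c r ∧
    ∀ x ∈ lev v 0, ∀ y ∈ lev v 0, dist x c = dist y c → v x = v y := by
  have hM := h.max_pos
  have hmem : M / 2 ∈ Ioo 0 M := ⟨by linarith, by linarith⟩
  set c := centroid v (M / 2)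
  have hlev : ∀ t ∈ Ioo 0 M, lev v t = ball c (rad v t) := fun t ht => by
    rw [h.lev_eq_ball ht, h.centroid_eq_centroid ht hmem]
  have hbdd : BddAbove (rad v '' Ioo 0 M) := by
    refine ⟨rad v 0, ?_⟩
    rintro _ ⟨t, ht, rfl⟩
    exact sqrt_le_sqrt (div_le_div_of_nonneg_right
      (h.area_anti (mem_Ici.2 le_rfl) (mem_Ici.2 ht.1.le) ht.1.le) pi_pos.le)
  have hlt : ∀ x ∈ lev v 0, ∃ t ∈ Ioo 0 M, t < v x := fun x hx =>
    ⟨v x / 2, ⟨half_pos hx, (half_lt_self hx).trans_le (h.le_max x)⟩, half_lt_self hx⟩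
  refine ⟨c, sSup (rad v '' Ioo 0 M), ?_, ?_, ?_⟩
  · exact (h.rad_pos hmem.1.le (h.lev_nonempty hmem.2)).trans_le
      (le_csSup hbdd (mem_image_of_mem _ hmem))
  · ext x
    constructor
    · intro hx
      obtain ⟨t, ht, htx⟩ := hlt x hx
      have : x ∈ ball c (rad v t) := hlev t ht ▸ htx
      exact (mem_ball.1 this).trans_le (le_csSup hbdd (mem_image_of_mem _ ht))
    · intro hx
      obtain ⟨_, ⟨t, ht, rfl⟩, hlt⟩ := exists_lt_of_lt_csSup ⟨_, mem_image_of_mem _ hmem⟩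
        (mem_ball.1 hx)
      have : x ∈ lev v t := (hlev t ht).symm ▸ mem_ball.2 hlt
      exact ht.1.trans this
  · have aux : ∀ x ∈ lev v 0, ∀ y, dist x c = dist y c → v x ≤ v y := fun x hx y hxy => by
      refine le_of_forall_lt fun t htx => ?_
      have ht' : max t (v x / 2) < v x := max_lt htx (half_lt_self hx)
      have ht : max t (v x / 2) ∈ Ioo 0 M :=
        ⟨(half_pos hx).trans_le (le_max_right _ _), ht'.trans_le (h.le_max x)⟩
      have h1 : x ∈ ball c (rad v (max t (v x / 2))) := hlev _ ht ▸ ht'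
      have h2 : y ∈ lev v (max t (v x / 2)) := by
        rw [hlev _ ht, mem_ball, ← hxy]; exact h1
      exact (le_max_left _ _).trans_lt h2
    exact fun x hx y hy hxy => le_antisymm (aux x hx y hxy) (aux y hy x hxy.symm)

end IsExtremal

lemma integral_comp_dist (φ : ℝ → ℝ) (c : Plane) :
    ∫ x, φ (dist x c) = 2 * π * ∫ s in Ioi (0 : ℝ), s * φ s := by
  have h1 : ∫ x, φ (dist x c) = ∫ x : Plane, φ ‖x‖ := by
    simp only [dist_eq_norm]
    exact integral_sub_right_eq_self (fun x : Plane => φ ‖x‖) c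
  have h2 : volume.real (ball (0 : Plane) 1) = π := by
    rw [measureReal_def, volume_ball_plane _ zero_le_one, one_pow, mul_one,
      ENNReal.toReal_ofReal pi_pos.le]
  rw [h1, integral_fun_norm_addHaar, h2]
  simp [mul_assoc]

/-- A profile which is radial about the center of the disk where it is positive. -/
structure IsRadial (f : ℝ → ℝ) (v : Plane → ℝ) (c : Plane) (R : ℝ) : Prop
    extends IsProfile f v where
  radius_pos : 0 < R
  lev_eq : lev v 0 = ball c R
  radial : ∀ x y, dist x c = dist y c → v x = v y

namespace IsRadial

open Topology
open scoped RealInnerProductSpace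

variable {f : ℝ → ℝ} {v : Plane → ℝ} {c : Plane} {R : ℝ}

/-- The point of the plane at signed distance `s` from `c` in the first coordinate direction. -/
def ray (c : Plane) (s : ℝ) : Plane := c + s • EuclideanSpace.single 0 1

lemma dist_ray (c : Plane) {s : ℝ} (hs : 0 ≤ s) : dist (ray c s) c = s := by
  simp [ray, norm_smul, abs_of_nonneg hs]

lemma hasDerivAt_ray (c : Plane) (s : ℝ) :
    HasDerivAt (ray c) (EuclideanSpace.single 0 1) s := by
  have := ((hasDerivAt_id s).smul_const (EuclideanSpace.single (0 : Fin 2) (1 : ℝ))).const_add c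
  rw [one_smul] at this
  exact this

lemma continuous_ray (c : Plane) : Continuous (ray c) :=
  continuous_iff_continuousAt.2 fun s => (hasDerivAt_ray c s).continuousAt

lemma eq_ray (h : IsRadial f v c R) (x : Plane) : v x = v (ray c (dist x c)) :=
  h.radial _ _ (dist_ray c dist_nonneg).symm

lemma ray_pos (h : IsRadial f v c R) {s : ℝ} (hs : s ∈ Ico 0 R) : 0 < v (ray c s) := by
  have : ray c s ∈ lev v 0 := by
    rw [h.lev_eq, mem_ball, dist_ray c hs.1]; exact hs.2
  exact this

lemma ray_eq_zero (h : IsRadial f v c R) {s : ℝ} (hs : R ≤ s) : v (ray c s) = 0 := by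
  have : ray c s ∉ lev v 0 := by
    rw [h.lev_eq, mem_ball, dist_ray c (h.radius_pos.le.trans hs)]; exact not_lt.2 hs
  exact le_antisymm (not_lt.1 this) (h.nonneg _)

/-- The radial derivative. -/
def radDeriv (v : Plane → ℝ) (c : Plane) (s : ℝ) : ℝ :=
  fderiv ℝ v (ray c s) (EuclideanSpace.single 0 1)

lemma hasDerivAt_ray_comp (h : IsRadial f v c R) {s : ℝ} (hs : s ∈ Ico 0 R) :
    HasDerivAt (fun s => v (ray c s)) (radDeriv v c s) s :=
  (h.differentiableAt (h.ray_pos hs)).hasFDerivAt.comp_hasDerivAt s (hasDerivAt_ray c s)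

lemma differentiableAt_partial (h : IsRadial f v c R) {x : Plane} (hx : 0 < v x) (w : Plane) :
    DifferentiableAt ℝ (fun y => fderiv ℝ v y w) x :=
  ((h.contDiffOn_fderiv.contDiffAt ((h.isOpen_lev 0).mem_nhds hx)).differentiableAt
    (by norm_num)).clm_apply (differentiableAt_const w)

lemma hasDerivAt_radDeriv (h : IsRadial f v c R) {s : ℝ} (hs : s ∈ Ico 0 R) :
    HasDerivAt (radDeriv v c) (fderiv ℝ (fun y => fderiv ℝ v y (EuclideanSpace.single 0 1)) (ray c s)
      (EuclideanSpace.single 0 1)) s :=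
  (h.differentiableAt_partial (h.ray_pos hs) _).hasFDerivAt.comp_hasDerivAt s (hasDerivAt_ray c s)

lemma second_tangential (h : IsRadial f v c R) {s : ℝ} (hs : s ∈ Ioo 0 R) :
    fderiv ℝ (fun y => fderiv ℝ v y (EuclideanSpace.single 1 1)) (ray c s)
      (EuclideanSpace.single 1 1) = radDeriv v c s / s := by
  set e : Plane := EuclideanSpace.single 1 1 with he
  have hs' : s ∈ Ico 0 R := ⟨hs.1.le, hs.2⟩
  set z : ℝ → Plane := fun τ => ray c s + τ • e with hz
  have hzd : ∀ τ, HasDerivAt z e τ := fun τ => by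
    simpa [hz] using ((hasDerivAt_id τ).smul_const e).const_add (ray c s)
  have hz0 : z 0 = ray c s := by simp [hz]
  set ρ : ℝ → ℝ := fun τ => √(s ^ 2 + τ ^ 2) with hρ
  have hρc : Continuous ρ := by fun_prop
  have hρ0 : ρ 0 = s := by simp [hρ, sqrt_sq hs.1.le]
  have hρpos : ∀ τ, 0 < ρ τ := fun τ => sqrt_pos.2 (by have := pow_pos hs.1 2; positivity)
  have hzρ : ∀ τ, dist (z τ) c = ρ τ := fun τ => by
    rw [EuclideanSpace.dist_eq]
    simp [hz, ray, he, hρ, Fin.sum_univ_two, Real.dist_eq, sq_abs]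
  have hvz : ∀ τ, v (z τ) = v (ray c (ρ τ)) := fun τ => by rw [h.eq_ray, hzρ]
  have hρd : ∀ τ, HasDerivAt ρ (τ / ρ τ) τ := fun τ => by
    have h1 : HasDerivAt (fun τ => s ^ 2 + τ ^ 2) (2 * τ) τ := by
      simpa using ((hasDerivAt_id τ).pow 2).const_add (s ^ 2)
    refine (h1.sqrt (by have := pow_pos hs.1 2; positivity)).congr_deriv ?_
    have := (hρpos τ).ne'
    change 2 * τ / (2 * ρ τ) = τ / ρ τ
    field_simp
  have hev : ∀ᶠ τ in 𝓝 0, ρ τ < R := hρc.continuousAt.eventually_lt_const (by rw [hρ0]; exact hs.2)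
  have hpart : ∀ᶠ τ in 𝓝 0, fderiv ℝ v (z τ) e = τ * (radDeriv v c (ρ τ) / ρ τ) := by
    filter_upwards [hev] with τ hτ
    have hmem : ρ τ ∈ Ico 0 R := ⟨(hρpos τ).le, hτ⟩
    have h1 : HasDerivAt (fun τ => v (z τ)) (fderiv ℝ v (z τ) e) τ :=
      (h.differentiableAt (by rw [hvz]; exact h.ray_pos hmem)).hasFDerivAt.comp_hasDerivAt τ (hzd τ)
    have h2 : HasDerivAt (fun τ => v (ray c (ρ τ))) (radDeriv v c (ρ τ) * (τ / ρ τ)) τ :=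
      (h.hasDerivAt_ray_comp hmem).comp τ (hρd τ)
    simp only [hvz] at h1
    rw [h1.unique h2]
    ring
  have hk : ContinuousAt (fun τ => radDeriv v c (ρ τ) / ρ τ) 0 := by
    refine ContinuousAt.div ?_ hρc.continuousAt (hρpos 0).ne'
    refine ContinuousAt.comp (g := radDeriv v c) ?_ hρc.continuousAt
    rw [hρ0]
    exact (h.hasDerivAt_radDeriv hs').continuousAt
  have hd1 : HasDerivAt (fun τ => τ * (radDeriv v c (ρ τ) / ρ τ)) (radDeriv v c s / s) 0 := by
    rw [hasDerivAt_iff_tendsto_slope]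
    have h3 : Tendsto (fun τ => radDeriv v c (ρ τ) / ρ τ) (𝓝[≠] 0) (𝓝 (radDeriv v c s / s)) := by
      have := hk.tendsto
      rw [hρ0] at this
      exact this.mono_left nhdsWithin_le_nhds
    refine h3.congr' ?_
    filter_upwards [self_mem_nhdsWithin] with τ hτ
    have : τ ≠ 0 := hτ
    simp [slope_def_field, this]
  have hd2 : HasDerivAt (fun τ => fderiv ℝ v (z τ) e)
      (fderiv ℝ (fun y => fderiv ℝ v y e) (ray c s) e) 0 := by
    have h4 := (h.differentiableAt_partial (h.ray_pos hs') e).hasFDerivAt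
    rw [← hz0] at h4 ⊢
    exact h4.comp_hasDerivAt 0 (hzd 0)
  exact hd2.unique (hd1.congr_of_eventuallyEq hpart)

lemma radial_pde (h : IsRadial f v c R) {s : ℝ} (hs : s ∈ Ioo 0 R) :
    HasDerivAt (fun s => s * radDeriv v c s) (-(s * f (v (ray c s)))) s := by
  have hs' : s ∈ Ico 0 R := ⟨hs.1.le, hs.2⟩
  have h1 := (hasDerivAt_id s).mul (h.hasDerivAt_radDeriv hs')
  refine h1.congr_deriv ?_
  have h2 := h.pde _ (h.ray_pos hs')
  rw [lap, Fin.sum_univ_two, h.second_tangential hs] at h2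
  have := hs.1.ne'
  rw [← h2, id]
  field_simp
  ring

lemma continuous_comp_ray (h : IsRadial f v c R) : Continuous fun s => v (ray c s) :=
  h.cont.comp (continuous_ray c)

lemma continuous_source (h : IsRadial f v c R) : Continuous fun s => s * f (v (ray c s)) :=
  continuous_id.mul (h.f_cont.comp h.continuous_comp_ray)

lemma mul_radDeriv_eq (h : IsRadial f v c R) {s : ℝ} (hs : s ∈ Ioo 0 R) :
    s * radDeriv v c s = -∫ τ in (0 : ℝ)..s, τ * f (v (ray c τ)) := by
  set W : ℝ → ℝ := fun s => s * radDeriv v c s + ∫ τ in (0 : ℝ)..s, τ * f (v (ray c τ)) with hW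
  have hd : ∀ t ∈ Ioo 0 R, HasDerivAt W 0 t := fun t ht => by
    refine ((h.radial_pde ht).add (h.continuous_source.integral_hasStrictDerivAt 0 t).hasDerivAt
      ).congr_deriv ?_
    simp
  have hc : ContinuousAt W 0 := by
    have h0 : (0 : ℝ) ∈ Ico 0 R := ⟨le_rfl, h.radius_pos⟩
    exact (continuousAt_id.mul (h.hasDerivAt_radDeriv h0).continuousAt).add
      (h.continuous_source.integral_hasStrictDerivAt 0 0).hasDerivAt.continuousAt
  have hconst : ∀ t ∈ Ioo 0 R, W t = W s := fun t ht =>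
    isOpen_Ioo.is_const_of_deriv_eq_zero isPreconnected_Ioo
      (fun τ hτ => (hd τ hτ).differentiableAt.differentiableWithinAt)
      (fun τ hτ => (hd τ hτ).deriv) ht hs
  have h1 : Tendsto W (𝓝[>] 0) (𝓝 (W 0)) := hc.tendsto.mono_left nhdsWithin_le_nhds
  have h2 : Tendsto W (𝓝[>] 0) (𝓝 (W s)) := by
    refine tendsto_const_nhds.congr' ?_
    filter_upwards [Ioo_mem_nhdsGT h.radius_pos] with t ht using (hconst t ht).symm
  have h3 := tendsto_nhds_unique h2 h1
  simp only [hW, zero_mul, intervalIntegral.integral_same, add_zero] at h3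
  linarith

lemma integral_mul_primitive (h : IsRadial f v c R) :
    ∫ s in (0 : ℝ)..R, 2 * (s * ∫ τ in (0 : ℝ)..v (ray c s), f τ)
      = (∫ τ in (0 : ℝ)..R, τ * f (v (ray c τ))) ^ 2 / 2 := by
  set P : ℝ → ℝ := fun s => ∫ τ in (0 : ℝ)..s, τ * f (v (ray c τ)) with hP
  set F : ℝ → ℝ := fun t => ∫ τ in (0 : ℝ)..t, f τ with hF
  have hPd : ∀ s, HasDerivAt P (s * f (v (ray c s))) s := fun s =>
    (h.continuous_source.integral_hasStrictDerivAt 0 s).hasDerivAt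
  have hFd : ∀ t, HasDerivAt F (f t) t := fun t =>
    (h.f_cont.integral_hasStrictDerivAt 0 t).hasDerivAt
  have hPc : Continuous P := continuous_iff_continuousAt.2 fun s => (hPd s).continuousAt
  have hFc : Continuous fun s => F (v (ray c s)) :=
    (continuous_iff_continuousAt.2 fun s => (hFd s).continuousAt).comp h.continuous_comp_ray
  have key := intervalIntegral.integral_eq_sub_of_hasDerivAt_of_le
    (f := fun s => s ^ 2 * F (v (ray c s)) + P s ^ 2 / 2)
    (f' := fun s => 2 * (s * F (v (ray c s)))) h.radius_pos.le
    (((continuous_id.pow 2).mul hFc).add ((hPc.pow 2).div_const 2)).continuousOn (fun s hs => ?_)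
    (((continuous_id.mul hFc).const_mul 2).intervalIntegrable _ _)
  · refine key.trans ?_
    have hP0 : P 0 = 0 := by simp [hP]
    have hFR : F (v (ray c R)) = 0 := by simp [hF, h.ray_eq_zero le_rfl]
    simp only [hP0, hFR]
    ring
  · have hs' : s ∈ Ico 0 R := ⟨hs.1.le, hs.2⟩
    have h1 : HasDerivAt (fun s => F (v (ray c s))) (f (v (ray c s)) * radDeriv v c s) s :=
      (hFd _).comp s (h.hasDerivAt_ray_comp hs')
    have h2 := (((hasDerivAt_id s).pow 2).mul h1).add (((hPd s).pow 2).div_const 2)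
    refine h2.congr_deriv ?_
    have h3 : s * radDeriv v c s = -P s := h.mul_radDeriv_eq hs
    have h4 : P s = -(s * radDeriv v c s) := by linarith
    simp [h4]
    ring

lemma integral_lev_comp (h : IsRadial f v c R) {φ : ℝ → ℝ} (hφ : φ 0 = 0) :
    ∫ x in lev v 0, φ (v x) = 2 * π * ∫ s in (0 : ℝ)..R, s * φ (v (ray c s)) := by
  rw [setIntegral_eq_integral_of_forall_compl_eq_zero fun x hx => by
    rw [le_antisymm (not_lt.1 hx) (h.nonneg x), hφ]]
  have h1 : (fun x => φ (v x)) = fun x => φ (v (ray c (dist x c))) :=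
    funext fun x => by rw [← h.eq_ray x]
  rw [h1, integral_comp_dist (fun s => φ (v (ray c s))), intervalIntegral.integral_of_le h.radius_pos.le]
  congr 1
  refine setIntegral_eq_of_subset_of_forall_sdiff_eq_zero measurableSet_Ioi Ioc_subset_Ioi_self
    fun s hs => ?_
  have : R ≤ s := le_of_not_ge fun hsR => hs.2 ⟨hs.1, hsR⟩
  rw [h.ray_eq_zero this, hφ, mul_zero]

/-- Radial profiles attain equality in the bound for the potential energy. -/
theorem integral_primitive_eq (h : IsRadial f v c R) :
    8 * π * ∫ x in lev v 0, ∫ τ in (0 : ℝ)..v x, f τ = mass f v 0 ^ 2 := by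
  have h1 := h.integral_mul_primitive
  rw [intervalIntegral.integral_const_mul] at h1
  rw [mass, h.integral_lev_comp h.f_zero,
    h.integral_lev_comp (φ := fun t => ∫ τ in (0 : ℝ)..t, f τ) (by simp)]
  linear_combination 8 * π ^ 2 * h1

end IsRadial

lemma IsProfile.integral_primitive_eq_iff {f : ℝ → ℝ} {v : Plane → ℝ} (h : IsProfile f v)
    (hne : (lev v 0).Nonempty) :
    8 * π * ∫ x in lev v 0, ∫ τ in (0 : ℝ)..v x, f τ = mass f v 0 ^ 2 ↔
      ∃ (c : Plane) (r : ℝ), 0 < r ∧ lev v 0 = ball c r ∧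
        ∀ x ∈ lev v 0, ∀ y ∈ lev v 0, dist x c = dist y c → v x = v y := by
  constructor
  · intro heq
    obtain ⟨x₀, hx₀⟩ := h.cont.exists_forall_ge_of_hasCompactSupport h.supp
    have hM : 0 < v x₀ := by
      obtain ⟨x, hx⟩ := hne
      exact lt_of_lt_of_le hx (hx₀ x)
    refine IsExtremal.exists_ball (f := f) (M := v x₀) ⟨h, hx₀, hM, ⟨x₀, rfl⟩, ?_⟩
    filter_upwards [h.flux_eq_of_eq heq, ae_restrict_mem (h.measurableSet_lev 0)] with y hy hy0
    exact (h.flux_le hy0).2 hy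
  · rintro ⟨c, r, hr, hball, hrad⟩
    refine IsRadial.integral_primitive_eq (c := c) (R := r) ⟨h, hr, hball, fun x y hxy => ?_⟩
    have hiff : x ∈ lev v 0 ↔ y ∈ lev v 0 := by rw [hball, mem_ball, mem_ball, hxy]
    by_cases hx : x ∈ lev v 0
    · exact hrad x hx y (hiff.1 hx) hxy
    · have hy := mt hiff.2 hx
      rw [le_antisymm (not_lt.1 hx) (h.nonneg x), le_antisymm (not_lt.1 hy) (h.nonneg y)]

namespace IsSol

open Topology

variable {Ω : Set Plane} {p lam α : ℝ} {ψ : Plane → ℝ}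

/-- The positive part of `α + λψ`, extended by zero outside `Ω`. -/
def plasma (Ω : Set Plane) (lam α : ℝ) (ψ : Plane → ℝ) : Plane → ℝ :=
  Ω.indicator fun x => max (α + lam * ψ x) 0

/-- The power nonlinearity in the equation satisfied by `plasma`. -/
def source (p lam : ℝ) (t : ℝ) : ℝ := lam * max t 0 ^ p

lemma lev_plasma {t : ℝ} (ht : 0 ≤ t) :
    lev (plasma Ω lam α ψ) t = {x ∈ Ω | t < α + lam * ψ x} := by
  ext x
  by_cases hx : x ∈ Ω <;> simp [lev, plasma, hx, not_lt.2 ht]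

lemma isCompact_nonneg (h : IsSol Ω p lam α ψ) (hbdd : Bornology.IsBounded Ω) :
    IsCompact {x ∈ closure Ω | 0 ≤ α + lam * ψ x} := by
  have hc : ContinuousOn (fun x => α + lam * ψ x) (closure Ω) :=
    continuousOn_const.add (continuousOn_const.mul h.contOn)
  exact isCompact_of_isClosed_isBounded (hc.preimage_isClosed_of_isClosed isClosed_closure isClosed_Ici)
    (hbdd.closure.subset fun x hx => hx.1)

lemma nonneg_subset (h : IsSol Ω p lam α ψ) (hopen : IsOpen Ω) (hα : α < 0) :
    {x ∈ closure Ω | 0 ≤ α + lam * ψ x} ⊆ Ω := fun x hx => by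
  by_contra hxΩ
  have h0 := h.bdry x (by rw [hopen.frontier_eq]; exact ⟨hx.1, hxΩ⟩)
  have := hx.2
  rw [h0] at this
  linarith

lemma plasma_eq_zero {x : Plane} (hx : x ∉ {x ∈ closure Ω | 0 ≤ α + lam * ψ x}) :
    plasma Ω lam α ψ x = 0 := by
  by_cases hxΩ : x ∈ Ω
  · have : α + lam * ψ x < 0 := not_le.1 fun hh => hx ⟨subset_closure hxΩ, hh⟩
    simp [plasma, hxΩ, this.le]
  · simp [plasma, hxΩ]

lemma continuous_plasma (h : IsSol Ω p lam α ψ) (hopen : IsOpen Ω)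
    (hbdd : Bornology.IsBounded Ω) (hα : α < 0) : Continuous (plasma Ω lam α ψ) := by
  rw [continuous_iff_continuousAt]
  intro x
  by_cases hx : x ∈ Ω
  · have hψ : ContinuousAt ψ x := h.smooth.continuousOn.continuousAt (hopen.mem_nhds hx)
    have hu : ContinuousAt (fun x => max (α + lam * ψ x) 0) x := by fun_prop
    refine hu.congr ?_
    filter_upwards [hopen.mem_nhds hx] with y hy
    simp [plasma, hy]
  · have hxK : x ∉ {x ∈ closure Ω | 0 ≤ α + lam * ψ x} := fun hh =>
      hx (h.nonneg_subset hopen hα hh)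
    refine continuousAt_const.congr (f := fun _ => (0 : ℝ)) ?_
    filter_upwards [(h.isCompact_nonneg hbdd).isClosed.isOpen_compl.mem_nhds hxK] with y hy
    exact (plasma_eq_zero hy).symm

lemma isOpen_pos (h : IsSol Ω p lam α ψ) (hopen : IsOpen Ω) :
    IsOpen {x ∈ Ω | 0 < α + lam * ψ x} :=
  (continuousOn_const.add (continuousOn_const.mul h.smooth.continuousOn)).isOpen_inter_preimage
    hopen isOpen_Ioi

lemma plasma_apply {x : Plane} (hx : x ∈ {x ∈ Ω | 0 < α + lam * ψ x}) :
    plasma Ω lam α ψ x = α + lam * ψ x := by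
  simp [plasma, hx.1, hx.2.le]

lemma fderiv_plasma (h : IsSol Ω p lam α ψ) (hopen : IsOpen Ω) {x : Plane}
    (hx : x ∈ {x ∈ Ω | 0 < α + lam * ψ x}) :
    fderiv ℝ (plasma Ω lam α ψ) x = lam • fderiv ℝ ψ x := by
  have he : plasma Ω lam α ψ =ᶠ[𝓝 x] fun y => α + lam * ψ y := by
    filter_upwards [(h.isOpen_pos hopen).mem_nhds hx] with y hy using plasma_apply hy
  have hψ : DifferentiableAt ℝ ψ x :=
    (h.smooth.contDiffAt (hopen.mem_nhds hx.1)).differentiableAt (by norm_num)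
  rw [he.fderiv_eq, fderiv_const_add, fderiv_const_mul hψ]

lemma gradient_plasma (h : IsSol Ω p lam α ψ) (hopen : IsOpen Ω) {x : Plane}
    (hx : x ∈ {x ∈ Ω | 0 < α + lam * ψ x}) :
    gradient (plasma Ω lam α ψ) x = lam • gradient ψ x := by
  rw [gradient, gradient, h.fderiv_plasma hopen hx, map_smulₛₗ]
  simp

lemma lap_plasma (h : IsSol Ω p lam α ψ) (hopen : IsOpen Ω) {x : Plane}
    (hx : x ∈ {x ∈ Ω | 0 < α + lam * ψ x}) :
    lap (plasma Ω lam α ψ) x = lam * lap ψ x := by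
  rw [lap, lap, Finset.mul_sum]
  refine Finset.sum_congr rfl fun i _ => ?_
  set w : Plane := EuclideanSpace.single i 1
  have he : (fun y => fderiv ℝ (plasma Ω lam α ψ) y w) =ᶠ[𝓝 x]
      fun y => lam * fderiv ℝ ψ y w := by
    filter_upwards [(h.isOpen_pos hopen).mem_nhds hx] with y hy
    rw [h.fderiv_plasma hopen hy]
    rfl
  have hψ : DifferentiableAt ℝ (fun y => fderiv ℝ ψ y w) x :=
    (((h.smooth.fderiv_of_isOpen hopen (m := 1) (by norm_num)).contDiffAt
      (hopen.mem_nhds hx.1)).differentiableAt (by norm_num)).clm_apply (differentiableAt_const w)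
  rw [he.fderiv_eq, fderiv_const_mul hψ]
  rfl

lemma isProfile_plasma (h : IsSol Ω p lam α ψ) (hopen : IsOpen Ω) (hbdd : Bornology.IsBounded Ω)
    (hp : 1 ≤ p) (hlam : 0 < lam) (hα : α < 0) :
    IsProfile (source p lam) (plasma Ω lam α ψ) where
  cont := h.continuous_plasma hopen hbdd hα
  supp := HasCompactSupport.intro (h.isCompact_nonneg hbdd) fun _ hx => plasma_eq_zero hx
  nonneg x := indicator_nonneg (fun _ _ => le_max_right _ _) x
  smooth := by
    change ContDiffOn ℝ 2 _ (lev (plasma Ω lam α ψ) 0)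
    rw [lev_plasma le_rfl]
    exact (contDiffOn_const.add (contDiffOn_const.mul
      (h.smooth.mono fun x hx => hx.1))).congr fun x hx => plasma_apply hx
  grad_bdd := by
    have hc : ContinuousOn (gradient ψ) Ω :=
      (InnerProductSpace.toDual ℝ Plane).symm.continuous.comp_continuousOn
        (h.smooth.continuousOn_fderiv_of_isOpen hopen (by norm_num))
    obtain ⟨C, hC⟩ := (h.isCompact_nonneg hbdd).exists_bound_of_continuousOn
      (hc.mono (h.nonneg_subset hopen hα))
    refine ⟨lam * C, fun x hx => ?_⟩
    have hx' : x ∈ {x ∈ Ω | 0 < α + lam * ψ x} := by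
      rw [← lev_plasma le_rfl]; exact hx
    rw [h.gradient_plasma hopen hx', norm_smul, Real.norm_of_nonneg hlam.le]
    exact mul_le_mul_of_nonneg_left (hC x ⟨subset_closure hx'.1, hx'.2.le⟩) hlam.le
  f_cont := continuous_const.mul ((continuous_id.max continuous_const).rpow_const
    fun _ => Or.inr (by linarith))
  f_mono s t hst := mul_le_mul_of_nonneg_left (rpow_le_rpow (le_max_right _ _)
    (max_le_max_right 0 hst) (by linarith)) hlam.le
  f_pos t ht := mul_pos hlam (rpow_pos_of_pos (lt_max_of_lt_left ht) p)
  f_zero := by simp [source, zero_rpow (by linarith : p ≠ 0)]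
  pde x hx := by
    have hx' : x ∈ {x ∈ Ω | 0 < α + lam * ψ x} := by
      rw [← lev_plasma le_rfl]; exact hx
    rw [h.lap_plasma hopen hx', source, plasma_apply hx', ← h.pde x hx'.1]
    ring

lemma mass_plasma (h : IsSol Ω p lam α ψ) (hopen : IsOpen Ω) (hp : 1 ≤ p) :
    mass (source p lam) (plasma Ω lam α ψ) 0 = lam := by
  rw [mass, lev_plasma le_rfl]
  have h1 : ∫ x in {x ∈ Ω | 0 < α + lam * ψ x}, source p lam (plasma Ω lam α ψ x)
      = ∫ x in {x ∈ Ω | 0 < α + lam * ψ x}, lam * max (α + lam * ψ x) 0 ^ p :=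
    setIntegral_congr_fun (h.isOpen_pos hopen).measurableSet fun x hx => by
      simp only [source, plasma_apply hx]
  have h2 : ∫ x in {x ∈ Ω | 0 < α + lam * ψ x}, lam * max (α + lam * ψ x) 0 ^ p
      = ∫ x in Ω, lam * max (α + lam * ψ x) 0 ^ p := by
    refine (setIntegral_eq_of_subset_of_forall_sdiff_eq_zero hopen.measurableSet
      (fun x hx => hx.1) fun x hx => ?_).symm
    have : α + lam * ψ x ≤ 0 := not_lt.1 fun hh => hx.2 ⟨hx.1, hh⟩
    rw [max_eq_right this, zero_rpow (by linarith), mul_zero]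
  rw [h1, h2, integral_const_mul, h.constr, mul_one]

lemma source_mul_self (hp : 1 ≤ p) {t : ℝ} (ht : 0 ≤ t) :
    source p lam t * t = (p + 1) * ∫ τ in (0 : ℝ)..t, source p lam τ := by
  have h1 : ∫ τ in (0 : ℝ)..t, source p lam τ = ∫ τ in (0 : ℝ)..t, lam * τ ^ p :=
    intervalIntegral.integral_congr fun τ hτ => by
      rw [uIcc_of_le ht] at hτ
      simp only [source, max_eq_left hτ.1]
  have hp1 : p + 1 ≠ 0 := by linarith
  rw [h1, intervalIntegral.integral_const_mul, integral_rpow (Or.inl (by linarith)),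
    zero_rpow hp1, source, max_eq_left ht, rpow_add_one' ht hp1]
  field_simp
  ring

lemma energy_eq (h : IsSol Ω p lam α ψ) (hopen : IsOpen Ω) (hbdd : Bornology.IsBounded Ω)
    (hp : 1 ≤ p) (hlam : 0 < lam) (hα : α < 0) :
    lam ^ 2 * ∫ x in {x ∈ Ω | 0 < α + lam * ψ x}, ‖gradient ψ x‖ ^ 2
      = (p + 1) * ∫ x in lev (plasma Ω lam α ψ) 0,
        ∫ τ in (0 : ℝ)..plasma Ω lam α ψ x, source p lam τ := by
  have hv := h.isProfile_plasma hopen hbdd hp hlam hα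
  have h1 : ∫ x in lev (plasma Ω lam α ψ) 0, ‖gradient (plasma Ω lam α ψ) x‖ ^ 2
      = ∫ x in {x ∈ Ω | 0 < α + lam * ψ x}, lam ^ 2 * ‖gradient ψ x‖ ^ 2 := by
    rw [lev_plasma le_rfl]
    refine setIntegral_congr_fun (h.isOpen_pos hopen).measurableSet fun x hx => ?_
    simp only [h.gradient_plasma hopen hx, norm_smul, Real.norm_of_nonneg hlam.le, mul_pow]
  rw [← integral_const_mul, ← h1, hv.integral_gradient_sq, ← integral_const_mul]
  exact setIntegral_congr_fun (hv.measurableSet_lev 0) fun x hx => source_mul_self hp (le_of_lt hx)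

end IsSol

/-- Lemma 1.3: for `N = 2` and a solution of `(P)_λ` with `α_λ < 0`, the Dirichlet energy
on the plasma region `Ω₊ = {α + λψ > 0}` is at most `(p+1)/(8π)`, with equality iff `Ω₊` is
a disk and `ψ_λ` is radial in `Ω₊`. -/
theorem statement2 (Ω : Set (EuclideanSpace ℝ (Fin 2)))
    (hopen : IsOpen Ω) (hconn : IsConnected Ω) (hbdd : Bornology.IsBounded Ω)
    (hvol : volume Ω = 1) (p : ℝ) (hp : 1 ≤ p)
    (lam α : ℝ) (ψ : EuclideanSpace ℝ (Fin 2) → ℝ)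
    (hlam : 0 < lam) (hsol : IsSol Ω p lam α ψ) (hα : α < 0) :
    (∫ x in {x ∈ Ω | 0 < α + lam * ψ x}, ‖gradient ψ x‖ ^ 2) ≤ (p + 1) / (8 * π) ∧
    ((∫ x in {x ∈ Ω | 0 < α + lam * ψ x}, ‖gradient ψ x‖ ^ 2) = (p + 1) / (8 * π) ↔
      ∃ (c : EuclideanSpace ℝ (Fin 2)) (r : ℝ) (g : ℝ → ℝ), 0 < r ∧ {x ∈ Ω | 0 < α + lam * ψ x} = ball c r ∧
        ∀ x ∈ {x ∈ Ω | 0 < α + lam * ψ x}, ψ x = g (dist x c)) := by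
  have hv := hsol.isProfile_plasma hopen hbdd hp hlam hα
  have hm := hsol.mass_plasma hopen hp
  have hE := hsol.energy_eq hopen hbdd hp hlam hα
  have hle := hv.integral_primitive_le
  have hne : (lev (IsSol.plasma Ω lam α ψ) 0).Nonempty := by
    by_contra hcon
    rw [not_nonempty_iff_eq_empty] at hcon
    rw [mass, hcon, setIntegral_empty] at hm
    exact hlam.ne hm
  have hiff := hv.integral_primitive_eq_iff hne
  have hlev : lev (IsSol.plasma Ω lam α ψ) 0 = {x ∈ Ω | 0 < α + lam * ψ x} :=
    IsSol.lev_plasma le_rfl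
  rw [hm] at hle hiff
  have hp1 : 0 < p + 1 := by linarith
  have hl2 : 0 < lam ^ 2 := by positivity
  have h8 : 0 < 8 * π := by positivity
  generalize ∫ x in {x ∈ Ω | 0 < α + lam * ψ x}, ‖gradient ψ x‖ ^ 2 = E at hE ⊢
  generalize ∫ x in lev (IsSol.plasma Ω lam α ψ) 0,
    ∫ τ in (0 : ℝ)..IsSol.plasma Ω lam α ψ x, IsSol.source p lam τ = I at hE hle hiff
  have hkey : lam ^ 2 * (E * (8 * π)) = (p + 1) * (8 * π * I) := by
    linear_combination 8 * π * hE
  have heq : E = (p + 1) / (8 * π) ↔ 8 * π * I = lam ^ 2 := by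
    rw [eq_div_iff h8.ne']
    constructor <;> intro h
    · refine mul_left_cancel₀ hp1.ne' ?_
      rw [← hkey, h, mul_comm]
    · refine mul_left_cancel₀ hl2.ne' ?_
      rw [hkey, h, mul_comm]
  refine ⟨?_, heq.trans (hiff.trans ?_)⟩
  · rw [le_div_iff₀ h8]
    refine le_of_mul_le_mul_left ?_ hl2
    rw [hkey, mul_comm (lam ^ 2)]
    exact mul_le_mul_of_nonneg_left hle hp1.le
  rw [hlev]
  constructor
  · rintro ⟨c, r, hr, hball, hrad⟩
    refine ⟨c, r, fun s => (IsSol.plasma Ω lam α ψ (IsRadial.ray c s) - α) / lam, hr, hball,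
      fun x hx => ?_⟩
    have hd : dist (IsRadial.ray c (dist x c)) c = dist x c := IsRadial.dist_ray c dist_nonneg
    have hy : IsRadial.ray c (dist x c) ∈ {x ∈ Ω | 0 < α + lam * ψ x} := by
      rw [hball, mem_ball, hd, ← mem_ball, ← hball]
      exact hx
    simp only [← hrad x hx _ hy hd.symm, IsSol.plasma_apply hx]
    field_simp
    ring
  · rintro ⟨c, r, g, hr, hball, hg⟩
    refine ⟨c, r, hr, hball, fun x hx y hy hxy => ?_⟩
    rw [IsSol.plasma_apply hx, IsSol.plasma_apply hy, hg x hx, hg y hy, hxy]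
end
end

section
/- Let (α_λ,ψ_λ) be a solution of (P)_λ with α_λ < 0 and set Ω_+ = {α_λ+λψ_λ > 0}, Ω_− = {α_λ+λψ_λ < 0}. Then 2E_λ = ∫_{Ω_+}|∇ψ_λ|² − α_λ/λ, where E_λ = ½∫_Ω|∇ψ_λ|² is the energy; in particular ∫_{Ω_−}|∇ψ_λ|² = −α_λ/λ and ∫_{{α_λ+λψ_λ = 0}}|∇ψ_λ|² = 0. -/
open MeasureTheory Metric Filter Real Set
noncomputable section

/-- The integral of a directional derivative of a compactly supported `C¹` function vanishes. -/
lemma integral_fderiv_apply_eq_zero {E : Type*} [NormedAddCommGroup E] [NormedSpace ℝ E]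
    [FiniteDimensional ℝ E] [MeasurableSpace E] [BorelSpace E] {μ : Measure E}
    [μ.IsAddHaarMeasure] {V : E → ℝ} (hV : ContDiff ℝ 1 V) (hc : HasCompactSupport V) (v : E) :
    Integrable (fun x => fderiv ℝ V x v) μ ∧ ∫ x, fderiv ℝ V x v ∂μ = 0 := by
  have hi : Integrable (fun x => fderiv ℝ V x v) μ :=
    ((hV.continuous_fderiv one_ne_zero).clm_apply continuous_const).integrable_of_hasCompactSupport
      (hc.fderiv_apply (𝕜 := ℝ) v)
  have h := integral_mul_fderiv_eq_neg_fderiv_mul_of_integrable (μ := μ) (f := V)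
    (g := fun _ => (1 : ℝ)) (v := v) (by simpa using hi) (by simp)
    (by simpa using hV.continuous.integrable_of_hasCompactSupport hc)
    (fun x _ => (hV.differentiable one_ne_zero).differentiableAt)
    (fun x _ => differentiableAt_const _)
  exact ⟨hi, by simpa using h.symm⟩

lemma integrableOn_of_isCompact_of_eq_zero {E : Type*} [TopologicalSpace E] [T2Space E]
    [MeasurableSpace E] [BorelSpace E] {μ : Measure E} [IsFiniteMeasureOnCompacts μ] {Ω K : Set E}
    {u : E → ℝ} (hΩ : IsOpen Ω) (hK : IsCompact K) (hKΩ : K ⊆ Ω) (hu : ContinuousOn u Ω)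
    (h0 : ∀ x ∈ Ω, x ∉ K → u x = 0) : IntegrableOn u Ω μ :=
  ((hu.mono hKΩ).integrableOn_compact hK).of_forall_sdiff_eq_zero hΩ.measurableSet
    fun x hx => h0 x hx.1 hx.2

lemma norm_gradient_sq_eq_sum {N : ℕ} (ψ : EuclideanSpace ℝ (Fin N) → ℝ)
    (x : EuclideanSpace ℝ (Fin N)) :
    ‖gradient ψ x‖ ^ 2 = ∑ i, fderiv ℝ ψ x (EuclideanSpace.single i 1) ^ 2 := by
  rw [EuclideanSpace.real_norm_sq_eq]
  refine Finset.sum_congr rfl fun i _ => ?_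
  rw [← inner_gradient_left, EuclideanSpace.inner_single_right]
  simp

lemma continuousOn_norm_gradient_sq {N : ℕ} {Ω : Set (EuclideanSpace ℝ (Fin N))}
    {ψ : EuclideanSpace ℝ (Fin N) → ℝ} (hΩ : IsOpen Ω) (hψ : ContDiffOn ℝ 2 ψ Ω) :
    ContinuousOn (fun x => ‖gradient ψ x‖ ^ 2) Ω := by
  have h : ContinuousOn (fderiv ℝ ψ) Ω := hψ.continuousOn_fderiv_of_isOpen hΩ (by norm_num)
  exact (((InnerProductSpace.toDual ℝ _).symm.continuous.comp_continuousOn h).norm).pow 2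

/-- If `ψ` vanishes on the boundary, the set where `|ψ| ≥ ε` is a compact subset of `Ω`. -/
lemma isCompact_le_abs {E : Type*} [PseudoMetricSpace E] [ProperSpace E] {Ω : Set E} {ψ : E → ℝ}
    {ε : ℝ} (hΩ : IsOpen Ω) (hb : Bornology.IsBounded Ω) (hψ : ContinuousOn ψ (closure Ω))
    (h0 : ∀ x ∈ frontier Ω, ψ x = 0) (hε : 0 < ε) : IsCompact {x ∈ Ω | ε ≤ |ψ x|} := by
  have : {x ∈ Ω | ε ≤ |ψ x|} = closure Ω ∩ (fun x => |ψ x|) ⁻¹' Ici ε := by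
    ext x
    refine ⟨fun h => ⟨subset_closure h.1, h.2⟩, fun h => ⟨?_, h.2⟩⟩
    by_contra hx
    have := h0 x (by rw [hΩ.frontier_eq]; exact ⟨h.1, hx⟩)
    have h2 : ε ≤ |ψ x| := h.2
    rw [this, abs_zero] at h2
    linarith
  rw [this]
  exact isCompact_of_isClosed_isBounded
    (hψ.abs.preimage_isClosed_of_isClosed isClosed_closure isClosed_Ici)
    (hb.closure.subset inter_subset_left)

/-- Testing `-Δψ = f` against `∫_0^ψ h`, for `h` vanishing near zero. -/
lemma setIntegral_comp_mul_norm_gradient_sq {N : ℕ} {Ω : Set (EuclideanSpace ℝ (Fin N))}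
    {ψ f : EuclideanSpace ℝ (Fin N) → ℝ} (hΩ : IsOpen Ω) (hb : Bornology.IsBounded Ω)
    (hψ : ContinuousOn ψ (closure Ω)) (hψ2 : ContDiffOn ℝ 2 ψ Ω)
    (h0 : ∀ x ∈ frontier Ω, ψ x = 0) (hf : ContinuousOn f Ω) (hpde : ∀ x ∈ Ω, -lap ψ x = f x)
    {h : ℝ → ℝ} (hh : Continuous h) {ε : ℝ} (hε : 0 < ε) (hhε : ∀ t, |t| < ε → h t = 0) :
    IntegrableOn (fun x => h (ψ x) * ‖gradient ψ x‖ ^ 2) Ω ∧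
      ∫ x in Ω, h (ψ x) * ‖gradient ψ x‖ ^ 2 = ∫ x in Ω, (∫ t in (0 : ℝ)..ψ x, h t) * f x := by
  set K := {x ∈ Ω | ε ≤ |ψ x|}
  have hK : IsCompact K := isCompact_le_abs hΩ hb hψ h0 hε
  have hKΩ : K ⊆ Ω := fun x hx => hx.1
  have hlt : ∀ x ∈ Ω, x ∉ K → |ψ x| < ε := fun x hx hxK => by
    by_contra hc; exact hxK ⟨hx, not_lt.1 hc⟩
  set g : ℝ → ℝ := fun s => ∫ t in (0 : ℝ)..s, h t with hg
  have hgd : ∀ s, HasDerivAt g (h s) s := fun s => (hh.integral_hasStrictDerivAt 0 s).hasDerivAt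
  have hgC : ContDiff ℝ 1 g := contDiff_one_iff_deriv.2
    ⟨fun s => (hgd s).differentiableAt, by rwa [show deriv g = h from funext fun s => (hgd s).deriv]⟩
  have hg0 : ∀ s, |s| < ε → g s = 0 := fun s hs => by
    rw [hg]
    refine intervalIntegral.integral_zero_ae (Eventually.of_forall fun t ht => hhε t ?_)
    have := abs_sub_left_of_mem_uIcc (uIoc_subset_uIcc ht)
    simp only [sub_zero] at this
    linarith
  have hψc : ContinuousOn ψ Ω := hψ.mono subset_closure
  have hi1 : IntegrableOn (fun x => h (ψ x) * ‖gradient ψ x‖ ^ 2) Ω :=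
    integrableOn_of_isCompact_of_eq_zero hΩ hK hKΩ
      ((hh.comp_continuousOn hψc).mul (continuousOn_norm_gradient_sq hΩ hψ2))
      fun x hx hxK => by simp [hhε _ (hlt x hx hxK)]
  have hi2 : IntegrableOn (fun x => g (ψ x) * f x) Ω :=
    integrableOn_of_isCompact_of_eq_zero hΩ hK hKΩ
      ((hgC.continuous.comp_continuousOn hψc).mul hf)
      fun x hx hxK => by simp [hg0 _ (hlt x hx hxK)]
  refine ⟨hi1, ?_⟩
  set W : Fin N → EuclideanSpace ℝ (Fin N) → ℝ :=
    fun i x => g (ψ x) * fderiv ℝ ψ x (EuclideanSpace.single i 1) with hW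
  have hd : ∀ i, ContDiffOn ℝ 1 (fun x => fderiv ℝ ψ x (EuclideanSpace.single i 1)) Ω := fun i =>
    (hψ2.fderiv_of_isOpen hΩ (by norm_num)).clm_apply contDiffOn_const
  have hWd : ∀ i, ContDiffOn ℝ 1 (W i) Ω := fun i =>
    (hgC.comp_contDiffOn (hψ2.of_le (by norm_num))).mul (hd i)
  have hV0 : ∀ i, ∀ x ∉ K, Ω.indicator (W i) x = 0 := fun i x hx => by
    by_cases hxΩ : x ∈ Ω
    · simp [hW, hxΩ, hg0 _ (hlt x hxΩ hx)]
    · simp [hxΩ]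
  have hVc : ∀ i, HasCompactSupport (Ω.indicator (W i)) := fun i => .intro hK (hV0 i)
  have hVd : ∀ i, ContDiff ℝ 1 (Ω.indicator (W i)) := fun i => contDiff_iff_contDiffAt.2 fun x => by
    by_cases hx : x ∈ Ω
    · refine ((hWd i).contDiffAt (hΩ.mem_nhds hx)).congr_of_eventuallyEq ?_
      filter_upwards [hΩ.mem_nhds hx] with y hy using indicator_of_mem hy _
    · refine (contDiffAt_const (c := (0 : ℝ))).congr_of_eventuallyEq ?_
      filter_upwards [hK.isClosed.isOpen_compl.mem_nhds fun hxK => hx (hKΩ hxK)] with y hy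
        using hV0 i y hy
  have hz := fun i => integral_fderiv_apply_eq_zero (μ := volume) (hVd i) (hVc i)
    (EuclideanSpace.single i 1)
  have hsum : ∫ x, ∑ i, fderiv ℝ (Ω.indicator (W i)) x (EuclideanSpace.single i 1) = 0 := by
    rw [integral_finsetSum _ fun i _ => (hz i).1]
    exact Finset.sum_eq_zero fun i _ => (hz i).2
  have hout : ∀ x ∉ Ω, ∑ i, fderiv ℝ (Ω.indicator (W i)) x (EuclideanSpace.single i 1) = 0 :=
    fun x hx => Finset.sum_eq_zero fun i _ => by
      have : Ω.indicator (W i) =ᶠ[nhds x] fun _ => 0 := by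
        filter_upwards [hK.isClosed.isOpen_compl.mem_nhds fun hxK => hx (hKΩ hxK)] with y hy
          using hV0 i y hy
      rw [this.fderiv_eq]; simp
  have hin : ∀ x ∈ Ω, ∑ i, fderiv ℝ (Ω.indicator (W i)) x (EuclideanSpace.single i 1) =
      h (ψ x) * ‖gradient ψ x‖ ^ 2 - g (ψ x) * f x := fun x hx => by
    rw [norm_gradient_sq_eq_sum, ← hpde x hx, lap, mul_neg, sub_neg_eq_add, Finset.mul_sum,
      Finset.mul_sum, ← Finset.sum_add_distrib]
    refine Finset.sum_congr rfl fun i _ => ?_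
    have : Ω.indicator (W i) =ᶠ[nhds x] W i := by
      filter_upwards [hΩ.mem_nhds hx] with y hy using indicator_of_mem hy _
    have h1 : HasFDerivAt ψ (fderiv ℝ ψ x) x :=
      ((hψ2.contDiffAt (hΩ.mem_nhds hx)).differentiableAt (by norm_num)).hasFDerivAt
    have h2 := (((hd i).contDiffAt (hΩ.mem_nhds hx)).differentiableAt one_ne_zero).hasFDerivAt
    have h3 := ((hgd (ψ x)).comp_hasFDerivAt x h1).mul h2
    rw [this.fderiv_eq]
    have h4 : fderiv ℝ (W i) x = _ := h3.fderiv
    rw [h4]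
    simp
    ring
  rw [← setIntegral_eq_integral_of_forall_compl_eq_zero hout,
    setIntegral_congr_fun hΩ.measurableSet hin, integral_sub hi1 hi2] at hsum
  linarith

section Solution

variable {N : ℕ} {Ω : Set (EuclideanSpace ℝ (Fin N))} {p lam α : ℝ}
  {ψ : EuclideanSpace ℝ (Fin N) → ℝ}

lemma IsSol.continuousOn (hsol : IsSol Ω p lam α ψ) : ContinuousOn ψ Ω :=
  hsol.contOn.mono subset_closure

lemma IsSol.continuousOn_rhs (hp : 1 ≤ p) (hsol : IsSol Ω p lam α ψ) :
    ContinuousOn (fun x => max (α + lam * ψ x) 0 ^ p) Ω :=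
  ((continuousOn_const.add (continuousOn_const.mul hsol.continuousOn)).sup
    continuousOn_const).rpow_const fun _ _ => Or.inr (by linarith)

lemma IsSol.integrableOn_rhs (hsol : IsSol Ω p lam α ψ) :
    IntegrableOn (fun x => max (α + lam * ψ x) 0 ^ p) Ω :=
  integrable_of_integral_eq_one hsol.constr

lemma rhs_eq_zero_of_le (hp : 1 ≤ p) (hlam : 0 < lam) {s : ℝ} (hs : s ≤ -α / lam) :
    max (α + lam * s) 0 ^ p = 0 := by
  rw [le_div_iff₀ hlam] at hs
  rw [max_eq_right (by linarith), Real.zero_rpow (by linarith)]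

/-- For `h` vanishing near zero and above the threshold `-α/λ`, the integral `∫ h(ψ)|∇ψ|²` is
the one-dimensional integral of `h` over `[0, -α/λ]`. -/
lemma IsSol.setIntegral_comp_mul_norm_gradient_sq (hΩ : IsOpen Ω) (hb : Bornology.IsBounded Ω)
    (hp : 1 ≤ p) (hlam : 0 < lam) (hsol : IsSol Ω p lam α ψ) {h : ℝ → ℝ} (hh : Continuous h)
    {ε : ℝ} (hε : 0 < ε) (hhε : ∀ t, |t| < ε → h t = 0) (hα : ∀ t, -α / lam ≤ t → h t = 0) :
    IntegrableOn (fun x => h (ψ x) * ‖gradient ψ x‖ ^ 2) Ω ∧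
      ∫ x in Ω, h (ψ x) * ‖gradient ψ x‖ ^ 2 = ∫ t in (0 : ℝ)..(-α / lam), h t := by
  obtain ⟨h1, h2⟩ := _root_.setIntegral_comp_mul_norm_gradient_sq hΩ hb hsol.contOn hsol.smooth
    hsol.bdry (hsol.continuousOn_rhs hp) hsol.pde hh hε hhε
  refine ⟨h1, ?_⟩
  have : ∀ x ∈ Ω, (∫ t in (0 : ℝ)..ψ x, h t) * max (α + lam * ψ x) 0 ^ p =
      (∫ t in (0 : ℝ)..(-α / lam), h t) * max (α + lam * ψ x) 0 ^ p := fun x _ => by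
    rcases le_total (ψ x) (-α / lam) with hx | hx
    · rw [rhs_eq_zero_of_le hp hlam hx, mul_zero, mul_zero]
    · rw [← intervalIntegral.integral_add_adjacent_intervals (b := -α / lam)
        (hh.intervalIntegrable _ _) (hh.intervalIntegrable _ _),
        intervalIntegral.integral_zero_ae (a := -α / lam)
          (Eventually.of_forall fun t ht => hα t ?_), add_zero]
      rw [uIoc_of_le hx] at ht
      exact ht.1.le
  rw [h2, setIntegral_congr_fun hΩ.measurableSet this, integral_const_mul, hsol.constr, mul_one]

lemma IsSol.norm_gradient_sq_eq_zero_of_neg (hΩ : IsOpen Ω) (hb : Bornology.IsBounded Ω)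
    (hp : 1 ≤ p) (hlam : 0 < lam) (hα : α < 0) (hsol : IsSol Ω p lam α ψ)
    {x : EuclideanSpace ℝ (Fin N)} (hx : x ∈ Ω) (hψx : ψ x < 0) : ‖gradient ψ x‖ ^ 2 = 0 := by
  have ht0 : 0 < -α / lam := div_pos (neg_pos.2 hα) hlam
  obtain ⟨δ, hδ, hδx⟩ : ∃ δ > 0, ψ x < -δ := ⟨-ψ x / 2, by linarith, by linarith⟩
  set h : ℝ → ℝ := fun t => max 0 (-t - δ)
  have hh : Continuous h := by fun_prop
  have hz : ∀ t, -δ ≤ t → h t = 0 := fun t ht => max_eq_left (by linarith)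
  obtain ⟨h1, h2⟩ := hsol.setIntegral_comp_mul_norm_gradient_sq hΩ hb hp hlam hh hδ
    (fun t ht => hz t (abs_lt.1 ht).1.le) (fun t ht => hz t (by linarith))
  rw [intervalIntegral.integral_zero_ae (Eventually.of_forall fun t ht => hz t (by
    rw [uIoc_of_le ht0.le] at ht; linarith [ht.1])),
    integral_eq_zero_iff_of_nonneg (fun y => mul_nonneg (le_max_left _ _) (sq_nonneg _)) h1] at h2
  have h3 := Measure.eqOn_open_of_ae_eq h2 hΩ ((hh.comp_continuousOn hsol.continuousOn).mul
    (continuousOn_norm_gradient_sq hΩ hsol.smooth)) continuousOn_const hx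
  refine (mul_eq_zero.1 h3).resolve_left (ne_of_gt ?_)
  exact lt_max_of_lt_right (by linarith)

lemma IsSol.norm_gradient_sq_eq_zero_of_nonpos (hΩ : IsOpen Ω) (hb : Bornology.IsBounded Ω)
    (hp : 1 ≤ p) (hlam : 0 < lam) (hα : α < 0) (hsol : IsSol Ω p lam α ψ)
    {x : EuclideanSpace ℝ (Fin N)} (hx : x ∈ Ω) (hψx : ψ x ≤ 0) : ‖gradient ψ x‖ ^ 2 = 0 := by
  rcases hψx.lt_or_eq with h | h
  · exact hsol.norm_gradient_sq_eq_zero_of_neg hΩ hb hp hlam hα hx h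
  by_contra hne
  have hmin : IsLocalMin ψ x := by
    filter_upwards [hΩ.mem_nhds hx, ((continuousOn_norm_gradient_sq hΩ hsol.smooth).continuousAt
      (hΩ.mem_nhds hx)).eventually_ne hne] with y hy hne'
    rw [h]
    by_contra hc
    exact hne' (hsol.norm_gradient_sq_eq_zero_of_neg hΩ hb hp hlam hα hy (not_le.1 hc))
  exact hne (by simp [gradient, hmin.fderiv_eq_zero])

lemma IsSol.integrableOn_norm_gradient_sq_of_le (hΩ : IsOpen Ω) (hb : Bornology.IsBounded Ω)
    (hsol : IsSol Ω p lam α ψ) {ε : ℝ} (hε : 0 < ε) :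
    IntegrableOn (fun x => ‖gradient ψ x‖ ^ 2) {x ∈ Ω | ε ≤ ψ x} :=
  (((continuousOn_norm_gradient_sq hΩ hsol.smooth).mono fun _ hx => hx.1).integrableOn_compact
    (isCompact_le_abs hΩ hb hsol.contOn hsol.bdry hε)).mono_set
      fun _ hx => ⟨hx.1, hx.2.trans (le_abs_self _)⟩

lemma IsSol.setIntegral_norm_gradient_sq_eq_threshold (hΩ : IsOpen Ω)
    (hb : Bornology.IsBounded Ω) (hp : 1 ≤ p) (hlam : 0 < lam) (hα : α < 0)
    (hsol : IsSol Ω p lam α ψ) : ∫ x in {x ∈ Ω | ψ x = -α / lam}, ‖gradient ψ x‖ ^ 2 = 0 := by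
  have ht0 : 0 < -α / lam := div_pos (neg_pos.2 hα) hlam
  set t₀ := -α / lam with ht₀
  set Z := {x ∈ Ω | ψ x = t₀}
  have hZm : MeasurableSet Z := by
    have : Z = {x ∈ Ω | t₀ ≤ |ψ x|} \ {x ∈ Ω | ψ x ≠ t₀} := by
      ext x
      simp only [Z, mem_ofPred_eq, Set.mem_sdiff, not_and, not_not]
      exact ⟨fun h => ⟨⟨h.1, h.2 ▸ le_abs_self _⟩, fun _ => h.2⟩, fun h => ⟨h.1.1, h.2 h.1.1⟩⟩
    rw [this]
    exact (isCompact_le_abs hΩ hb hsol.contOn hsol.bdry ht0).measurableSet.diff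
      (hsol.continuousOn.isOpen_inter_preimage hΩ isOpen_ne).measurableSet
  refine le_antisymm (le_of_forall_pos_le_add fun r hr => ?_)
    (setIntegral_nonneg hZm fun x _ => sq_nonneg _)
  obtain ⟨δ, hδ, hδt, hδr⟩ : ∃ δ > 0, 2 * δ ≤ t₀ ∧ 2 * δ ≤ r :=
    ⟨min t₀ r / 2, by positivity, by linarith [min_le_left t₀ r], by linarith [min_le_right t₀ r]⟩
  set h : ℝ → ℝ := fun t => max 0 (1 - |t - t₀| / δ) with hh_def
  have hh : Continuous h := by fun_prop
  have hnn : ∀ t, 0 ≤ h t := fun t => le_max_left _ _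
  have hle : ∀ t, h t ≤ 1 := fun t => max_le zero_le_one (by
    have : 0 ≤ |t - t₀| / δ := by positivity
    linarith)
  have hz : ∀ t, δ ≤ |t - t₀| → h t = 0 := fun t ht =>
    max_eq_left (by linarith [(one_le_div hδ).2 ht])
  obtain ⟨h1, h2⟩ := _root_.setIntegral_comp_mul_norm_gradient_sq hΩ hb hsol.contOn hsol.smooth
    hsol.bdry (hsol.continuousOn_rhs hp) hsol.pde hh hδ (fun t ht => hz t (by
      rw [abs_lt] at ht; rw [le_abs]; right; linarith))
  have hg : ∀ s, t₀ ≤ s → ∫ t in (0 : ℝ)..s, h t ≤ 2 * δ := fun s hs => by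
    rw [intervalIntegral.integral_of_le (by linarith)]
    calc ∫ t in Ioc 0 s, h t ≤ ∫ t in Ioc 0 s ∪ Icc (t₀ - δ) (t₀ + δ), h t :=
          setIntegral_mono_set ((hh.integrableOn_Ioc).union hh.integrableOn_Icc)
            (Eventually.of_forall hnn) subset_union_left.eventuallyLE
      _ = ∫ t in Icc (t₀ - δ) (t₀ + δ), h t :=
          setIntegral_eq_of_subset_of_forall_sdiff_eq_zero
            (measurableSet_Ioc.union measurableSet_Icc) subset_union_right fun t ht => hz t (by
              by_contra hc
              have := abs_lt.1 (not_le.1 hc)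
              exact ht.2 ⟨by linarith, by linarith⟩)
      _ ≤ ∫ t in Icc (t₀ - δ) (t₀ + δ), (1 : ℝ) :=
          setIntegral_mono hh.integrableOn_Icc continuous_const.integrableOn_Icc hle
      _ = 2 * δ := by
          rw [setIntegral_const]
          simp only [smul_eq_mul, mul_one, Real.volume_real_Icc]
          rw [max_eq_left (by linarith)]; ring
  calc ∫ x in Z, ‖gradient ψ x‖ ^ 2 = ∫ x in Z, h (ψ x) * ‖gradient ψ x‖ ^ 2 :=
        setIntegral_congr_fun hZm fun x hx => by simp [hh_def, hx.2]
    _ ≤ ∫ x in Ω, h (ψ x) * ‖gradient ψ x‖ ^ 2 :=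
        setIntegral_mono_set h1 (Eventually.of_forall fun x => mul_nonneg (hnn _) (sq_nonneg _))
          (LE.le.eventuallyLE fun x hx => hx.1)
    _ = ∫ x in Ω, (∫ t in (0 : ℝ)..ψ x, h t) * max (α + lam * ψ x) 0 ^ p := h2
    _ ≤ ∫ x in Ω, 2 * δ * max (α + lam * ψ x) 0 ^ p := by
        refine integral_mono_of_nonneg (Eventually.of_forall fun x => ?_)
          (hsol.integrableOn_rhs.const_mul _) (Eventually.of_forall fun x => ?_)
        all_goals
          rcases le_total (ψ x) t₀ with hx | hx
          · simp [rhs_eq_zero_of_le hp hlam hx]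
        · exact mul_nonneg (intervalIntegral.integral_nonneg (ht0.le.trans hx) fun t _ => hnn t)
            (Real.rpow_nonneg (le_max_right _ _) _)
        · exact mul_le_mul_of_nonneg_right (hg _ hx) (Real.rpow_nonneg (le_max_right _ _) _)
    _ = 2 * δ := by rw [integral_const_mul, hsol.constr, mul_one]
    _ ≤ 0 + r := by linarith

lemma IsSol.setIntegral_norm_gradient_sq_Ioo (hΩ : IsOpen Ω) (hb : Bornology.IsBounded Ω)
    (hp : 1 ≤ p) (hlam : 0 < lam) (hα : α < 0) (hsol : IsSol Ω p lam α ψ) :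
    ∫ x in {x ∈ Ω | ψ x ∈ Ioo 0 (-α / lam)}, ‖gradient ψ x‖ ^ 2 = -α / lam := by
  have ht0 : 0 < -α / lam := div_pos (neg_pos.2 hα) hlam
  set t₀ := -α / lam with ht₀
  set S := {x ∈ Ω | ψ x ∈ Ioo 0 t₀}
  have hS : IsOpen S := hsol.continuousOn.isOpen_inter_preimage hΩ isOpen_Ioo
  set D : EuclideanSpace ℝ (Fin N) → ℝ := fun x => ‖gradient ψ x‖ ^ 2
  set h : ℕ → ℝ → ℝ := fun n t => max 0 (min 1 ((n + 1) * min t (t₀ - t) - 1)) with hh_def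
  have hh : ∀ n, Continuous (h n) := fun n => by fun_prop
  have hnn : ∀ n t, 0 ≤ h n t := fun n t => le_max_left _ _
  have hle : ∀ n t, h n t ≤ 1 := fun n t => max_le zero_le_one (min_le_left _ _)
  have hz : ∀ (n : ℕ) t, min t (t₀ - t) ≤ 1 / ((n : ℝ) + 1) → h n t = 0 := fun n t ht => by
    rw [le_div_iff₀ (by positivity), mul_comm] at ht
    exact max_eq_left (min_le_of_right_le (by linarith))
  have hout : ∀ n t, t ∉ Ioo 0 t₀ → h n t = 0 := fun n t ht => hz n t (by
    have : (0 : ℝ) < 1 / (n + 1) := by positivity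
    refine le_trans ?_ this.le
    by_contra hc
    have := lt_min_iff.1 (not_le.1 hc)
    exact ht ⟨this.1, by linarith⟩)
  have hmono : ∀ t, Monotone fun n => h n t := fun t n m hnm => by
    by_cases ht : t ∈ Ioo 0 t₀
    · have : 0 ≤ min t (t₀ - t) := le_min ht.1.le (by linarith [ht.2])
      have hc : (n : ℝ) ≤ m := by exact_mod_cast hnm
      simp only [hh_def]
      gcongr
    · simp only [hout _ _ ht, le_refl]
  have hlim : ∀ t, Tendsto (fun n => h n t) atTop (nhds ((Ioo 0 t₀).indicator 1 t)) := fun t => by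
    by_cases ht : t ∈ Ioo 0 t₀
    · have hm : 0 < min t (t₀ - t) := lt_min ht.1 (by linarith [ht.2])
      rw [indicator_of_mem ht]
      refine tendsto_const_nhds.congr' ?_
      filter_upwards [eventually_ge_atTop ⌈2 / min t (t₀ - t)⌉₊] with n hn
      have h1 : 2 / min t (t₀ - t) ≤ n := Nat.ceil_le.1 hn
      rw [div_le_iff₀ hm] at h1
      simp only [hh_def, Pi.one_apply]
      rw [min_eq_left (by linarith), max_eq_right zero_le_one]
    · simp only [hout _ _ ht, indicator_of_notMem ht, tendsto_const_nhds]
  have hone : ∫ t in (0 : ℝ)..t₀, (Ioo 0 t₀).indicator (1 : ℝ → ℝ) t = t₀ := by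
    rw [intervalIntegral.integral_of_le ht0.le, integral_Ioc_eq_integral_Ioo,
      setIntegral_indicator measurableSet_Ioo, inter_self]
    simp [ht0.le]
  have hc : Tendsto (fun n => ∫ t in (0 : ℝ)..t₀, h n t) atTop (nhds t₀) := by
    have := intervalIntegral.tendsto_integral_filter_of_dominated_convergence (μ := volume)
      (a := 0) (b := t₀) (F := h) (l := atTop) (f := (Ioo 0 t₀).indicator 1) (fun _ => 1)
      (Eventually.of_forall fun n => (hh n).aestronglyMeasurable)
      (Eventually.of_forall fun n => Eventually.of_forall fun t _ => by
        rw [Real.norm_of_nonneg (hnn n t)]; exact hle n t)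
      intervalIntegrable_const (Eventually.of_forall fun t _ => hlim t)
    rwa [hone] at this
  have hI := fun n : ℕ => hsol.setIntegral_comp_mul_norm_gradient_sq hΩ hb hp hlam (hh n)
    (ε := 1 / (n + 1)) (by positivity)
    (fun t ht => hz n t (min_le_of_left_le (abs_lt.1 ht).2.le))
    (fun t ht => hout n t fun h' => absurd h'.2 (not_lt.2 ht))
  have hL := lintegral_tendsto_of_tendsto_of_monotone (μ := volume.restrict Ω)
    (f := fun n x => ENNReal.ofReal (h n (ψ x) * D x))
    (F := fun x => ENNReal.ofReal ((Ioo 0 t₀).indicator 1 (ψ x) * D x))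
    (fun n => (hI n).1.aemeasurable.ennreal_ofReal)
    (Eventually.of_forall fun x n m hnm => ENNReal.ofReal_le_ofReal
      (mul_le_mul_of_nonneg_right (hmono _ hnm) (sq_nonneg _)))
    (Eventually.of_forall fun x => ENNReal.tendsto_ofReal ((hlim (ψ x)).mul_const _))
  have hL' : (fun n => ∫⁻ x in Ω, ENNReal.ofReal (h n (ψ x) * D x)) =
      fun n => ENNReal.ofReal (∫ t in (0 : ℝ)..t₀, h n t) := funext fun n => by
    rw [← (hI n).2, ofReal_integral_eq_lintegral_ofReal (hI n).1
      (Eventually.of_forall fun x => mul_nonneg (hnn n _) (sq_nonneg _))]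
  rw [hL'] at hL
  have hEq := tendsto_nhds_unique hL (ENNReal.tendsto_ofReal hc)
  have hSΩ : ∫⁻ x in S, ENNReal.ofReal (D x) = ENNReal.ofReal t₀ := by
    rw [← hEq, ← inter_eq_self_of_subset_left (show S ⊆ Ω from fun x hx => hx.1),
      ← Measure.restrict_restrict hS.measurableSet, ← lintegral_indicator hS.measurableSet]
    refine setLIntegral_congr_fun hΩ.measurableSet fun x hx => ?_
    by_cases hxS : ψ x ∈ Ioo 0 t₀
    · simp [indicator_of_mem hxS, indicator_of_mem (show x ∈ S from ⟨hx, hxS⟩)]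
    · simp [indicator_of_notMem hxS, indicator_of_notMem (show x ∉ S from fun h' => hxS h'.2)]
  rw [integral_eq_lintegral_of_nonneg_ae (Eventually.of_forall fun x => sq_nonneg _)
    (((continuousOn_norm_gradient_sq hΩ hsol.smooth).mono fun x hx => hx.1).aestronglyMeasurable
      hS.measurableSet), hSΩ, ENNReal.toReal_ofReal ht0.le]

end Solution

/-- Lemma 2.1: for a solution of `(P)_λ` with `α_λ < 0`, with
`Ω₊ = {α + λψ > 0}`, `Ω₋ = {α + λψ < 0}` and `E_λ = ½∫_Ω |∇ψ_λ|²`, we have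
`2E_λ = ∫_{Ω₊}|∇ψ_λ|² - α/λ`, `∫_{Ω₋}|∇ψ_λ|² = -α/λ` and
`∫_{α+λψ=0}|∇ψ_λ|² = 0`. -/
theorem statement3 (N : ℕ) (hN : 2 ≤ N) (Ω : Set (EuclideanSpace ℝ (Fin N)))
    (hopen : IsOpen Ω) (hconn : IsConnected Ω) (hbdd : Bornology.IsBounded Ω)
    (hvol : volume Ω = 1) (p : ℝ) (hp : 1 ≤ p)
    (hpN : 2 < N → p < (N : ℝ) / ((N : ℝ) - 2))
    (lam α : ℝ) (ψ : EuclideanSpace ℝ (Fin N) → ℝ)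
    (hlam : 0 < lam) (hsol : IsSol Ω p lam α ψ) (hα : α < 0) :
    2 * ((1 : ℝ) / 2 * ∫ x in Ω, ‖gradient ψ x‖ ^ 2) =
        (∫ x in {x ∈ Ω | 0 < α + lam * ψ x}, ‖gradient ψ x‖ ^ 2) - α / lam ∧
    (∫ x in {x ∈ Ω | α + lam * ψ x < 0}, ‖gradient ψ x‖ ^ 2) = -(α / lam) ∧
    (∫ x in {x ∈ Ω | α + lam * ψ x = 0}, ‖gradient ψ x‖ ^ 2) = 0 := by
  have ht0 : 0 < -α / lam := div_pos (neg_pos.2 hα) hlam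
  have hneg : ∀ s, α + lam * s < 0 ↔ s < -α / lam := fun s => by
    rw [lt_div_iff₀ hlam, mul_comm s]; constructor <;> intro h <;> linarith
  have hpos : ∀ s, 0 < α + lam * s ↔ -α / lam < s := fun s => by
    rw [div_lt_iff₀ hlam, mul_comm s]; constructor <;> intro h <;> linarith
  have heq : ∀ s, α + lam * s = 0 ↔ s = -α / lam := fun s => by
    rw [eq_div_iff hlam.ne', mul_comm s]; constructor <;> intro h <;> linarith
  simp only [hneg, hpos, heq]
  have hopen' : ∀ {T : Set ℝ}, IsOpen T → IsOpen {x ∈ Ω | ψ x ∈ T} := fun hT =>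
    hsol.continuousOn.isOpen_inter_preimage hopen hT
  have hmL : MeasurableSet {x ∈ Ω | ψ x < -α / lam} := (hopen' isOpen_Iio).measurableSet
  have hzero : ∀ x ∈ {x ∈ Ω | ψ x < -α / lam} \ {x ∈ Ω | ψ x ∈ Ioo 0 (-α / lam)},
      ‖gradient ψ x‖ ^ 2 = 0 := fun x hx =>
    hsol.norm_gradient_sq_eq_zero_of_nonpos hopen hbdd hp hlam hα hx.1.1
      (not_lt.1 fun h => hx.2 ⟨hx.1.1, h, hx.1.2⟩)
  have hlow : ∫ x in {x ∈ Ω | ψ x < -α / lam}, ‖gradient ψ x‖ ^ 2 = -α / lam := by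
    rw [setIntegral_eq_of_subset_of_forall_sdiff_eq_zero hmL
      (fun x hx => ⟨hx.1, hx.2.2⟩) hzero]
    exact hsol.setIntegral_norm_gradient_sq_Ioo hopen hbdd hp hlam hα
  have hlevel := hsol.setIntegral_norm_gradient_sq_eq_threshold hopen hbdd hp hlam hα
  have hmP : MeasurableSet {x ∈ Ω | -α / lam < ψ x} := (hopen' isOpen_Ioi).measurableSet
  have hiL : IntegrableOn (fun x => ‖gradient ψ x‖ ^ 2) {x ∈ Ω | ψ x < -α / lam} :=
    Integrable.of_integral_ne_zero (by rw [hlow]; exact ht0.ne')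
  have hiU := hsol.integrableOn_norm_gradient_sq_of_le hopen hbdd ht0
  have hiP : IntegrableOn (fun x => ‖gradient ψ x‖ ^ 2) {x ∈ Ω | -α / lam < ψ x} :=
    hiU.mono_set fun x hx => ⟨hx.1, hx.2.le⟩
  have hiZ : IntegrableOn (fun x => ‖gradient ψ x‖ ^ 2) {x ∈ Ω | ψ x = -α / lam} :=
    hiU.mono_set fun x hx => ⟨hx.1, hx.2.ge⟩
  have hsplit : Ω = {x ∈ Ω | ψ x = -α / lam} ∪ {x ∈ Ω | ψ x < -α / lam} ∪
      {x ∈ Ω | -α / lam < ψ x} := by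
    ext x
    simp only [mem_union, mem_ofPred_eq]
    have := lt_trichotomy (ψ x) (-α / lam)
    tauto
  have htotal : ∫ x in Ω, ‖gradient ψ x‖ ^ 2 = 0 + -α / lam +
      ∫ x in {x ∈ Ω | -α / lam < ψ x}, ‖gradient ψ x‖ ^ 2 := by
    conv_lhs => rw [hsplit]
    rw [setIntegral_union _ hmP (hiZ.union hiL) hiP, setIntegral_union _ hmL hiZ hiL, hlow, hlevel]
    · exact Set.disjoint_left.2 fun x hx hx' => absurd hx'.2 hx.2.not_lt
    · refine Set.disjoint_left.2 fun x hx hx' => absurd hx'.2 (not_lt.2 ?_)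
      rcases hx with hx | hx
      exacts [hx.2.le, hx.2.le]
  refine ⟨?_, by rw [hlow, neg_div], hlevel⟩
  rw [htotal, neg_div]
  ring
end
end
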